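/- A closed subgroup H of GL(V), V a finite-dimensional real vector space, all of whose elements are elliptic (each generates a relatively compact subgroup), is compact. -/

import Mathlib

open Module

def PB {E : Type*} [AddCommGroup E] [Module ℝ E] (a : E →ₗ[ℝ] E) : Prop :=
  ∀ (f : Dual ℝ E) (v : E), ∃ C : ℝ, ∀ n : ℕ, |f ((a ^ n) v)| ≤ C

section trace
variable {n : Type*} [Fintype n] [DecidableEq n]

lemma matrix_root_norm_le (A : Matrix n n ℂ) (hA : ∀ i j, ∃ C : ℝ, ∀ k : ℕ, ‖(A ^ k) i j‖ ≤ C)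
    (z : ℂ) (hz : A.charpoly.IsRoot z) : ‖z‖ ≤ 1 := by
  classical
  have h1 : (Matrix.scalar n z - A).det = 0 := by
    rw [← Matrix.eval_charpoly]; exact hz
  obtain ⟨v, hv0, hv⟩ := Matrix.exists_mulVec_eq_zero_iff.2 h1
  have hAv : A.mulVec v = z • v := by
    rw [Matrix.sub_mulVec, sub_eq_zero] at hv
    rw [← hv]; simp [Matrix.scalar_apply]
  have hpow : ∀ k : ℕ, (A ^ k).mulVec v = z ^ k • v := by
    intro k
    induction k with
    | zero => simp
    | succ k ih =>
      rw [pow_succ, ← Matrix.mulVec_mulVec, hAv, Matrix.mulVec_smul, ih, smul_smul, pow_succ,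
        mul_comm]
  obtain ⟨i, hi⟩ : ∃ i, v i ≠ 0 := by
    by_contra h; push Not at h; exact hv0 (funext h)
  choose C hC using hA
  by_contra hlt
  push Not at hlt
  have hb : ∀ k : ℕ, ‖z‖ ^ k * ‖v i‖ ≤ ∑ j, C i j * ‖v j‖ := by
    intro k
    have := congrFun (hpow k) i
    have h2 : ‖z‖ ^ k * ‖v i‖ = ‖((A ^ k).mulVec v) i‖ := by
      rw [this]; simp
    rw [h2]
    refine (norm_sum_le _ _).trans (Finset.sum_le_sum fun j _ => ?_)
    rw [norm_mul]
    exact mul_le_mul_of_nonneg_right (hC i j k) (norm_nonneg _)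
  have ht := (tendsto_pow_atTop_atTop_of_one_lt hlt).atTop_mul_const (norm_pos_iff.2 hi)
  obtain ⟨k, hk⟩ := (ht.eventually_gt_atTop (∑ j, C i j * ‖v j‖)).exists
  exact absurd (hb k) (not_le.2 hk)

end trace

section
variable {E : Type*} [AddCommGroup E] [Module ℝ E] [FiniteDimensional ℝ E]

lemma unip_pb (a : E →ₗ[ℝ] E) (ha : PB a) (m : ℕ) (hn : (a - 1) ^ m = 0) : a = 1 := by
  by_contra hne
  have hN : a - 1 ≠ 0 := sub_ne_zero.2 hne
  have hnil : IsNilpotent (a - 1) := ⟨m, hn⟩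
  obtain ⟨k, hk0, hk1⟩ : ∃ k, (a - 1) ^ (k + 1) ≠ 0 ∧ (a - 1) ^ (k + 2) = 0 := by
    classical
    have hex : ∃ m, (a - 1) ^ m = 0 := ⟨m, hn⟩
    have hlt : 2 ≤ Nat.find hex := by
      rw [Nat.le_find_iff]
      intro j hj
      interval_cases j
      · intro h
        apply hN
        rw [pow_zero] at h
        rw [← mul_one (a - 1), h, mul_zero]
      · simpa using hN
    refine ⟨Nat.find hex - 2, Nat.find_min hex (by omega), ?_⟩
    have := Nat.find_spec hex
    rwa [show Nat.find hex - 2 + 2 = Nat.find hex by omega]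
  obtain ⟨v, hv⟩ : ∃ v, ((a - 1) ^ (k + 1)) v ≠ 0 := by
    by_contra h; push Not at h; exact hk0 (LinearMap.ext h)
  set w := ((a - 1) ^ k) v
  set u := ((a - 1) ^ (k + 1)) v
  have hw : a w = w + u := by
    have : u = (a - 1) w := by simp only [u, w, pow_succ', Module.End.mul_apply]
    rw [this]; simp
  have hu : a u = u := by
    have : (a - 1) u = 0 := by
      have : (a - 1) u = ((a - 1) ^ (k + 2)) v := by
        simp only [u, pow_succ', Module.End.mul_apply]
      rw [this, hk1]; rfl
    simpa [sub_eq_zero] using this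
  have hpow : ∀ j : ℕ, (a ^ j) w = w + (j : ℝ) • u := by
    intro j
    induction j with
    | zero => simp
    | succ j ih =>
      rw [pow_succ', Module.End.mul_apply, ih, map_add, map_smul, hw, hu]
      push_cast
      module
  obtain ⟨f, hf⟩ : ∃ f : Dual ℝ E, f u ≠ 0 := by
    by_contra h; push Not at h
    exact hv ((Module.forall_dual_apply_eq_zero_iff ℝ u).1 h)
  obtain ⟨C, hC⟩ := ha f w
  obtain ⟨j, hj⟩ := exists_nat_gt ((C + |f w|) / |f u|)
  have h1 := hC j
  rw [hpow, map_add, map_smul, smul_eq_mul] at h1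
  rw [div_lt_iff₀ (abs_pos.2 hf)] at hj
  have h2 : |(j : ℝ) * f u| ≤ |f w + j * f u| + |f w| := by
    have := abs_sub (f w + j * f u) (f w)
    simpa using this
  rw [abs_mul, Nat.abs_cast] at h2
  linarith

lemma pb_trace (a : E →ₗ[ℝ] E) (ha : PB a) :
    |LinearMap.trace ℝ E a| ≤ finrank ℝ E ∧
      (LinearMap.trace ℝ E a = finrank ℝ E → a = 1) := by
  classical
  let b := Module.finBasis ℝ E
  let A := LinearMap.toMatrix b b a
  let B : Matrix _ _ ℂ := A.map (algebraMap ℝ ℂ)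
  have hpow : ∀ k : ℕ, B ^ k = (A ^ k).map (algebraMap ℝ ℂ) := by
    intro k
    exact (map_pow (RingHom.mapMatrix (algebraMap ℝ ℂ)) A k).symm
  have hB : ∀ i j, ∃ C : ℝ, ∀ k : ℕ, ‖(B ^ k) i j‖ ≤ C := by
    intro i j
    obtain ⟨C, hC⟩ := ha (b.coord i) (b j)
    refine ⟨C, fun k => ?_⟩
    rw [hpow]
    have : A ^ k = LinearMap.toMatrix b b (a ^ k) := by
      simp only [A]
      exact (map_pow (LinearMap.toMatrixAlgEquiv b) a k).symm
    rw [this, Matrix.map_apply, LinearMap.toMatrix_apply]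
    simpa using hC k
  have hroots : ∀ z ∈ B.charpoly.roots, ‖z‖ ≤ 1 := fun z hz =>
    matrix_root_norm_le B hB z (Polynomial.isRoot_of_mem_roots hz)
  have htr : ((LinearMap.trace ℝ E a : ℝ) : ℂ) = B.charpoly.roots.sum := by
    rw [← Matrix.trace_eq_sum_roots_charpoly, LinearMap.trace_eq_matrix_trace ℝ b]
    simp [B, A, Matrix.trace]
  have hcard : B.charpoly.roots.card = finrank ℝ E := by
    rw [← (IsAlgClosed.splits B.charpoly).natDegree_eq_card_roots, Matrix.charpoly_natDegree_eq_dim]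
    simp
  constructor
  · have : |LinearMap.trace ℝ E a| = ‖B.charpoly.roots.sum‖ := by
      rw [← htr]; simp
    rw [this]
    refine (norm_multiset_sum_le _).trans ?_
    have := Multiset.sum_le_card_nsmul (B.charpoly.roots.map norm) 1 (by
      intro x hx
      obtain ⟨z, hz, rfl⟩ := Multiset.mem_map.1 hx
      exact hroots z hz)
    simpa [hcard] using this
  · intro heq
    have hall : ∀ z ∈ B.charpoly.roots, z = 1 := by
      have hre : (B.charpoly.roots.map (fun z => 1 - z.re)).sum = 0 := by
        rw [Multiset.sum_map_sub]
        have h1 : (B.charpoly.roots.map Complex.re).sum = finrank ℝ E := by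
          have := (map_multiset_sum Complex.reAddGroupHom B.charpoly.roots).symm
          rw [← htr] at this
          simpa [heq] using this
        rw [h1]; simp [hcard]
      intro z hz
      have hnn : ∀ z ∈ B.charpoly.roots, 0 ≤ 1 - z.re := fun z hz => by
        have := (Complex.re_le_norm z).trans (hroots z hz)
        linarith
      have h0 : 1 - z.re = 0 := by
        have := Multiset.single_le_sum (s := B.charpoly.roots.map (fun z => 1 - z.re)) (by
          intro x hx
          obtain ⟨z, hz, rfl⟩ := Multiset.mem_map.1 hx
          exact hnn z hz) _ (Multiset.mem_map_of_mem _ hz)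
        rw [hre] at this
        exact le_antisymm this (hnn z hz)
      have hn := hroots z hz
      have h2 : Complex.normSq z ≤ 1 := by
        rw [Complex.normSq_eq_norm_sq]; nlinarith [norm_nonneg z]
      rw [Complex.normSq_apply] at h2
      have hre1 : z.re = 1 := by linarith
      have him : z.im = 0 := by
        rw [hre1] at h2; nlinarith
      exact Complex.ext hre1 him
    have hchar : B.charpoly = (Polynomial.X - 1) ^ (finrank ℝ E) := by
      rw [(IsAlgClosed.splits B.charpoly).eq_prod_roots_of_monic (Matrix.charpoly_monic _),
        Multiset.eq_replicate_card.2 hall]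
      simp [hcard]
    have hB1 : (B - 1) ^ (finrank ℝ E) = 0 := by
      have := Matrix.aeval_self_charpoly B
      rw [hchar] at this
      simpa using this
    have hA1 : (A - 1) ^ (finrank ℝ E) = 0 := by
      have hinj : Function.Injective (RingHom.mapMatrix (m := Fin (finrank ℝ E)) (algebraMap ℝ ℂ)) :=
        Matrix.map_injective (algebraMap ℝ ℂ).injective
      apply hinj
      rw [map_pow, map_sub, map_one, map_zero]
      exact hB1
    apply unip_pb a ha (finrank ℝ E)
    apply (LinearMap.toMatrixAlgEquiv b).injective
    rw [map_pow, map_sub, map_one, map_zero]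
    exact hA1

end

open Module

section
variable {V : Type*} [AddCommGroup V] [Module ℝ V] [FiniteDimensional ℝ V]

lemma no_fix_of_trace_zero (j : V →ₗ[ℝ] V)
    (h : ∀ p : Polynomial ℝ, LinearMap.trace ℝ V (j * Polynomial.aeval j p) = 0)
    (w : V) (hw : j w = w) : w = 0 := by
  by_contra hw0
  have hIntg : IsIntegral ℝ j := Algebra.IsIntegral.isIntegral j
  have hm0 : minpoly ℝ j ≠ 0 := minpoly.ne_zero hIntg
  obtain ⟨q, hq, hq0⟩ := Polynomial.exists_eq_pow_rootMultiplicity_mul_and_not_dvd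
    (minpoly ℝ j) hm0 0
  set a := (minpoly ℝ j).rootMultiplicity 0
  rw [map_zero, sub_zero] at hq hq0
  have hcop : IsCoprime (Polynomial.X ^ (a + 1)) q :=
    IsCoprime.pow_left ((Polynomial.prime_X.coprime_iff_not_dvd).2 hq0)
  obtain ⟨u, v, huv⟩ := hcop
  have hev : ∀ p : Polynomial ℝ, (Polynomial.aeval j p) w = (p.eval 1) • w := by
    intro p
    induction p using Polynomial.induction_on' with
    | add p q hp hq => simp [hp, hq, add_smul]
    | monomial n c =>
      have : ∀ n : ℕ, (j ^ n) w = w := by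
        intro n
        induction n with
        | zero => simp
        | succ n ih => rw [pow_succ, Module.End.mul_apply, hw, ih]
      simp [Polynomial.aeval_monomial, this, Algebra.algebraMap_eq_smul_one]
  have hm1 : (minpoly ℝ j).eval 1 = 0 := by
    have := hev (minpoly ℝ j)
    rw [minpoly.aeval] at this
    have h2 := this.symm
    simpa [hw0] using h2
  have hq1 : q.eval 1 = 0 := by
    rw [hq] at hm1; simpa using hm1
  set e := Polynomial.aeval j (u * Polynomial.X ^ (a + 1)) with he
  have hew : e w = w := by
    rw [he, hev]
    have := congrArg (Polynomial.eval 1) huv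
    rw [Polynomial.eval_add, Polynomial.eval_mul (p := v), hq1] at this
    simp only [mul_zero, add_zero, Polynomial.eval_one] at this
    rw [this, one_smul]
  have hid : IsIdempotentElem e := by
    have h1 : e * (1 - e) = 0 := by
      have : (1 : V →ₗ[ℝ] V) - e = Polynomial.aeval j (v * q) := by
        rw [he, ← map_one (Polynomial.aeval (R := ℝ) j), ← huv, ← map_sub]; congr 1; ring
      rw [this, he, ← map_mul]
      have : u * Polynomial.X ^ (a + 1) * (v * q) = (u * v * Polynomial.X) * minpoly ℝ j := by
        rw [hq]; ring
      rw [this, map_mul, minpoly.aeval, mul_zero]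
    have h2 : e - e * e = 0 := by rw [← h1]; noncomm_ring
    exact (sub_eq_zero.1 h2).symm
  have htr : LinearMap.trace ℝ V e = 0 := by
    have : e = j * Polynomial.aeval j (u * Polynomial.X ^ a) := by
      rw [he, show u * Polynomial.X ^ (a + 1) = Polynomial.X * (u * Polynomial.X ^ a) by ring,
        map_mul, Polynomial.aeval_X]
    rw [this]; exact h _
  have := LinearMap.IsIdempotentElem.eq_zero_of_trace_eq_zero hid htr
  rw [this] at hew
  exact hw0 hew.symm

lemma bounded_of_cr {G : Type*} [Monoid G] (σ : G →* (V →ₗ[ℝ] V))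
    (hcr : ∀ W : Submodule ℝ V, (∀ g, ∀ w ∈ W, σ g w ∈ W) →
      ∃ W' : Submodule ℝ V, (∀ g, ∀ w ∈ W', σ g w ∈ W') ∧ IsCompl W W')
    (C : ℝ) (htr : ∀ g, |LinearMap.trace ℝ V (σ g)| ≤ C)
    (f : Dual ℝ (V →ₗ[ℝ] V)) : ∃ C, ∀ g, |f (σ g)| ≤ C := by
  classical
  let A : Subalgebra ℝ (V →ₗ[ℝ] V) := Algebra.adjoin ℝ (Set.range σ)
  have hA : Subalgebra.toSubmodule A = Submodule.span ℝ (Set.range σ) := by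
    rw [Algebra.adjoin_eq_span]
    congr 1
    have := Submonoid.closure_eq (MonoidHom.mrange σ)
    rw [MonoidHom.coe_mrange] at this
    rw [this, MonoidHom.coe_mrange]
  have hσA : ∀ g, σ g ∈ A := fun g => Algebra.subset_adjoin ⟨g, rfl⟩
  have hss : IsSemisimpleModule A V := by
    rw [isSemisimpleModule_iff]
    refine ⟨fun W => ?_⟩
    obtain ⟨W', hW', hc⟩ := hcr (W.restrictScalars ℝ) (fun g w hw =>
      W.smul_mem (⟨σ g, hσA g⟩ : A) hw)
    have hinv : ∀ a ∈ A, ∀ w ∈ W', a w ∈ W' := by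
      intro a ha w hw
      have ha' : a ∈ Subalgebra.toSubmodule A := ha
      rw [hA] at ha'
      induction ha' using Submodule.span_induction with
      | mem x hx => obtain ⟨g, rfl⟩ := hx; exact hW' g w hw
      | zero => simp
      | add x y hx hy h1 h2 =>
        exact W'.add_mem (h1 (by rw [← hA] at hx; exact hx)) (h2 (by rw [← hA] at hy; exact hy))
      | smul c x hx h1 => exact W'.smul_mem c (h1 (by rw [← hA] at hx; exact hx))
    refine ⟨{ W' with smul_mem' := fun a w hw => hinv a.1 a.2 w hw }, ?_⟩
    constructor
    · rw [Submodule.disjoint_def]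
      intro x hx hx'
      exact Submodule.disjoint_def.1 hc.disjoint x hx hx'
    · rw [codisjoint_iff, Submodule.eq_top_iff']
      intro x
      have : x ∈ W.restrictScalars ℝ ⊔ W' := by rw [hc.sup_eq_top]; trivial
      obtain ⟨y, hy, z, hz, rfl⟩ := Submodule.mem_sup.1 this
      exact Submodule.mem_sup.2 ⟨y, hy, z, hz, rfl⟩
  let Φ : A →ₗ[ℝ] Dual ℝ A :=
    LinearMap.mk₂ ℝ (fun a b => LinearMap.trace ℝ V (a.1 * b.1))
      (by intros; simp [add_mul]) (by intros; simp) (by intros; simp [mul_add])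
      (by intros; simp)
  have hΦ : Function.Injective Φ := by
    rw [← LinearMap.ker_eq_bot, LinearMap.ker_eq_bot']
    intro a ha
    have ha' : ∀ b ∈ A, LinearMap.trace ℝ V (a.1 * b) = 0 := fun b hb =>
      LinearMap.congr_fun ha ⟨b, hb⟩
    have key : ∀ W : Submodule A V, IsSimpleModule A W → ∀ w ∈ W, a • w = 0 := by
      intro W hW w hw
      by_contra hne
      have hat : IsAtom W := isSimpleModule_iff_isAtom.1 hW
      have hle : Submodule.span A {a • w} ≤ W := by
        rw [Submodule.span_singleton_le_iff_mem]; exact W.smul_mem a hw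
      have heq : Submodule.span A {a • w} = W := by
        rcases hat.le_iff.1 hle with h | h
        · exact absurd (Submodule.span_singleton_eq_bot.1 h) hne
        · exact h
      have hw' : w ∈ Submodule.span A {a • w} := by rw [heq]; exact hw
      obtain ⟨b, hb⟩ := Submodule.mem_span_singleton.1 hw'
      have hw0 : w = 0 := by
        apply no_fix_of_trace_zero (b.1 * a.1) _ w hb
        intro p
        rw [mul_assoc, LinearMap.trace_mul_comm, mul_assoc]
        apply ha'
        apply A.mul_mem _ b.2
        exact Polynomial.aeval_mem_adjoin_singleton ℝ _ |> fun h =>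
          (Algebra.adjoin_le (Set.singleton_subset_iff.2 (A.mul_mem b.2 a.2))) h
      apply hne
      rw [hw0, smul_zero]
    have hall : ∀ v : V, a • v = 0 := by
      intro v
      have hv : v ∈ sSup {m : Submodule A V | IsSimpleModule A m} := by
        rw [IsSemisimpleModule.sSup_simples_eq_top]; trivial
      rw [sSup_eq_iSup'] at hv
      induction hv using Submodule.iSup_induction' with
      | mem i x hx => exact key i.1 i.2 x hx
      | zero => simp
      | add x y _ _ h1 h2 => rw [smul_add, h1, h2, add_zero]
    exact Subtype.ext (LinearMap.ext hall)
  have hsurj : Function.Surjective Φ :=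
    (LinearMap.injective_iff_surjective_of_finrank_eq_finrank
      (Subspace.dual_finrank_eq).symm).1 hΦ
  obtain ⟨b, hb⟩ := hsurj (f.comp (Subalgebra.toSubmodule A).subtype)
  have hfb : ∀ g, f (σ g) = LinearMap.trace ℝ V (b.1 * σ g) := fun g =>
    (LinearMap.congr_fun hb ⟨σ g, hσA g⟩).symm
  have hb' : b.1 ∈ Submodule.span ℝ (Set.range σ) := by rw [← hA]; exact b.2
  have : ∃ C, ∀ g, |LinearMap.trace ℝ V (b.1 * σ g)| ≤ C := by
    generalize b.1 = x at hb'
    induction hb' using Submodule.span_induction with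
    | mem x hx =>
      obtain ⟨h, rfl⟩ := hx
      exact ⟨C, fun g => by rw [← map_mul]; exact htr _⟩
    | zero => exact ⟨0, by simp⟩
    | add x y _ _ h1 h2 =>
      obtain ⟨C1, h1⟩ := h1
      obtain ⟨C2, h2⟩ := h2
      refine ⟨C1 + C2, fun g => ?_⟩
      rw [add_mul, map_add]
      exact (abs_add_le _ _).trans (add_le_add (h1 g) (h2 g))
    | smul c x _ h1 =>
      obtain ⟨C1, h1⟩ := h1
      refine ⟨|c| * C1, fun g => ?_⟩
      rw [smul_mul_assoc, map_smul, smul_eq_mul, abs_mul]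
      exact mul_le_mul_of_nonneg_left (h1 g) (abs_nonneg _)
  obtain ⟨C', hC'⟩ := this
  exact ⟨C', fun g => by rw [hfb]; exact hC' g⟩
end

open Module

def Big {G : Type*} [Group G] (U : Set G) : Prop :=
  ∃ (ι : Type) (_ : Finite ι) (c : G → ι), ∀ g h, c g = c h → g⁻¹ * h ∈ U

lemma Big.inter {G : Type*} [Group G] {U U' : Set G} (h : Big U) (h' : Big U') :
    Big (U ∩ U') := by
  obtain ⟨ι, _, c, hc⟩ := h
  obtain ⟨κ, _, d, hd⟩ := h'
  refine ⟨ι × κ, inferInstance, fun g => (c g, d g), fun g h hgh => ?_⟩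
  rw [Prod.mk.injEq] at hgh
  exact ⟨hc g h hgh.1, hd g h hgh.2⟩

lemma norm_bdd_of_dual_bdd {ι E : Type*} [NormedAddCommGroup E] [NormedSpace ℝ E]
    [FiniteDimensional ℝ E] (x : ι → E) (h : ∀ f : Dual ℝ E, ∃ C, ∀ i, |f (x i)| ≤ C) :
    ∃ C, ∀ i, ‖x i‖ ≤ C := by
  let b := Module.finBasis ℝ E
  choose C hC using fun j => h (b.coord j)
  refine ⟨∑ j, C j * ‖b j‖, fun i => ?_⟩
  rw [← b.sum_repr (x i)]
  refine (norm_sum_le _ _).trans (Finset.sum_le_sum fun j _ => ?_)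
  rw [norm_smul]
  exact mul_le_mul_of_nonneg_right (hC j i) (norm_nonneg _)

section
variable {V : Type*} [AddCommGroup V] [Module ℝ V] [FiniteDimensional ℝ V]

lemma exists_big_of_bdd {G : Type*} [Group G] (σ : G →* (V →ₗ[ℝ] V))
    (hb : ∀ f : Dual ℝ (V →ₗ[ℝ] V), ∃ C, ∀ g, |f (σ g)| ≤ C) (ε : ℝ) (hε : 0 < ε) :
    ∃ U : Set G, Big U ∧ ∃ (X : Type) (_ : NormedAddCommGroup X) (_ : NormedSpace ℝ X)
      (e : V ≃ₗ[ℝ] X), ∀ s ∈ U, ∀ v, ‖e (σ s v - v)‖ ≤ ε * ‖e v‖ := by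
  let e : V ≃ₗ[ℝ] (Fin (finrank ℝ V) → ℝ) := (Module.finBasis ℝ V).equivFun
  let X := Fin (finrank ℝ V) → ℝ
  let L : (V →ₗ[ℝ] V) →ₗ[ℝ] (X →L[ℝ] X) :=
    (LinearMap.toContinuousLinearMap (E := X) (F' := X) (𝕜 := ℝ)).toLinearMap ∘ₗ
      (e.conj).toLinearMap
  have hL : ∀ a x, L a x = e (a (e.symm x)) := fun a x => rfl
  have hLmul : ∀ a b, L (a * b) = L a * L b := by
    intro a b; ext1 x
    rw [mul_apply_eq_comp, hL, hL, hL]; simp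
  have hL1 : L 1 = 1 := by
    ext1 x
    rw [hL]; simp
  obtain ⟨C, hC⟩ := norm_bdd_of_dual_bdd (fun g => L (σ g)) (fun f => hb (f ∘ₗ L))
  have hCp : 0 ≤ C := (norm_nonneg _).trans (hC 1)
  have htb : TotallyBounded (Set.range fun g => L (σ g)) := by
    have : Bornology.IsBounded (Set.range fun g => L (σ g)) :=
      isBounded_iff_forall_norm_le.2 ⟨C, by rintro _ ⟨g, rfl⟩; exact hC g⟩
    have : ProperSpace (X →L[ℝ] X) := FiniteDimensional.proper ℝ _
    exact (Bornology.IsBounded.isCompact_closure ‹_›).totallyBounded.subset subset_closure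
  set δ := ε / (2 * (C + 1)) with hδ
  have hδp : 0 < δ := by positivity
  obtain ⟨t, htf, ht⟩ := Metric.totallyBounded_iff.1 htb δ hδp
  have hcol : ∀ g, ∃ y : t, L (σ g) ∈ Metric.ball y.1 δ := by
    intro g
    have := ht ⟨g, rfl⟩
    simp only [Set.mem_iUnion] at this
    obtain ⟨y, hy, h⟩ := this
    exact ⟨⟨y, hy⟩, h⟩
  choose c hc using hcol
  refine ⟨{g | ‖L (σ g) - 1‖ ≤ ε}, ⟨t, htf, c, ?_⟩, X, inferInstance, inferInstance, e, ?_⟩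
  · intro g h hgh
    have h1 : ‖L (σ h) - L (σ g)‖ ≤ 2 * δ := by
      have a1 := hc g
      have a2 := hc h
      rw [hgh] at a1
      rw [Metric.mem_ball] at a1 a2
      rw [← dist_eq_norm]
      refine (dist_triangle_right _ _ ((c h).1)).trans ?_
      linarith
    have h2 : L (σ (g⁻¹ * h)) - 1 = L (σ g⁻¹) * (L (σ h) - L (σ g)) := by
      rw [mul_sub, ← hLmul, ← hLmul, ← map_mul, ← map_mul, inv_mul_cancel, map_one, hL1]
    show ‖L (σ (g⁻¹ * h)) - 1‖ ≤ ε
    rw [h2]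
    refine (norm_mul_le _ _).trans ?_
    refine (mul_le_mul (hC _) h1 (norm_nonneg _) hCp).trans ?_
    rw [hδ]
    have : C * (2 * (ε / (2 * (C + 1)))) = ε * (C / (C + 1)) := by field_simp
    rw [this]
    have : C / (C + 1) ≤ 1 := by rw [div_le_one (by positivity)]; linarith
    nlinarith
  · intro s hs v
    have : e (σ s v - v) = (L (σ s) - 1) (e v) := by
      rw [sub_apply, hL]; simp
    rw [this]
    exact ((L (σ s) - 1).le_opNorm (e v)).trans (mul_le_mul_of_nonneg_right hs (norm_nonneg _))

end

lemma exists_big {G : Type*} [Group G] (n : ℕ) : ∀ (V : Type*) [AddCommGroup V] [Module ℝ V]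
    [FiniteDimensional ℝ V] (_ : finrank ℝ V ≤ n) (σ : G →* (V →ₗ[ℝ] V)) (_ : ∀ g, PB (σ g))
    (ε : ℝ) (_ : 0 < ε),
    ∃ U : Set G, Big U ∧ ∀ S : Set G, S.Finite → S ⊆ U →
      ∃ (X : Type) (_ : NormedAddCommGroup X) (_ : NormedSpace ℝ X)
      (e : V ≃ₗ[ℝ] X), ∀ s ∈ S, ∀ v, ‖e (σ s v - v)‖ ≤ ε * ‖e v‖ := by
  have base : ∀ (V : Type _) [AddCommGroup V] [Module ℝ V]
    [FiniteDimensional ℝ V] (σ : G →* (V →ₗ[ℝ] V)) (_ : ∀ g, PB (σ g))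
    (_ : ∀ W : Submodule ℝ V, (∀ g, ∀ w ∈ W, σ g w ∈ W) → W = ⊥ ∨ W = ⊤)
    (ε : ℝ) (_ : 0 < ε),
    ∃ U : Set G, Big U ∧ ∀ S : Set G, S.Finite → S ⊆ U →
      ∃ (X : Type) (_ : NormedAddCommGroup X) (_ : NormedSpace ℝ X)
      (e : V ≃ₗ[ℝ] X), ∀ s ∈ S, ∀ v, ‖e (σ s v - v)‖ ≤ ε * ‖e v‖ := by
    intro V _ _ _ σ hσ hirr ε hε
    obtain ⟨U, hU, X, i1, i2, e, he⟩ := exists_big_of_bdd σ (bounded_of_cr σ (by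
      intro W hW
      rcases hirr W hW with rfl | rfl
      · exact ⟨⊤, by simp, isCompl_bot_top⟩
      · exact ⟨⊥, by simp, isCompl_top_bot⟩) _ (fun g => (pb_trace (σ g) (hσ g)).1)) ε hε
    exact ⟨U, hU, fun S _ hS => ⟨X, i1, i2, e, fun s hs => he s (hS hs)⟩⟩
  induction n with
  | zero =>
    intro V _ _ _ hn σ hσ ε hε
    refine base V σ hσ (fun W _ => Or.inl ?_) ε hε
    have : Subsingleton V := finrank_zero_iff.1 (Nat.le_zero.1 hn)
    exact Subsingleton.elim _ _
  | succ n ih =>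
    intro V _ _ _ hn σ hσ ε hε
    by_cases hirr : ∀ W : Submodule ℝ V, (∀ g, ∀ w ∈ W, σ g w ∈ W) → W = ⊥ ∨ W = ⊤
    · exact base V σ hσ hirr ε hε
    push Not at hirr
    obtain ⟨W, hW, hbot, htop⟩ := hirr
    let σ1 : G →* (W →ₗ[ℝ] W) :=
      { toFun := fun g => (σ g).restrict (hW g)
        map_one' := by ext; simp
        map_mul' := by intro a b; ext; simp }
    let σ2 : G →* ((V ⧸ W) →ₗ[ℝ] (V ⧸ W)) :=
      { toFun := fun g => W.mapQ W (σ g) (hW g)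
        map_one' := by ext; simp
        map_mul' := by intro a b; ext; simp }
    have h1 : ∀ g, PB (σ1 g) := by
      intro g f v
      obtain ⟨f', hf'⟩ := LinearMap.exists_extend f
      obtain ⟨C, hC⟩ := hσ g f' v
      refine ⟨C, fun k => ?_⟩
      have : ∀ k : ℕ, (((σ1 g) ^ k) v : V) = ((σ g) ^ k) v := by
        intro k
        induction k with
        | zero => simp
        | succ k ih => rw [pow_succ', pow_succ', End.mul_apply, End.mul_apply, ← ih]; rfl
      rw [← hf', LinearMap.comp_apply, Submodule.subtype_apply, this]
      exact hC k
    have h2 : ∀ g, PB (σ2 g) := by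
      intro g f v
      obtain ⟨v, rfl⟩ := W.mkQ_surjective v
      obtain ⟨C, hC⟩ := hσ g (f ∘ₗ W.mkQ) v
      refine ⟨C, fun k => ?_⟩
      have : ∀ k : ℕ, ((σ2 g) ^ k) (W.mkQ v) = W.mkQ (((σ g) ^ k) v) := by
        intro k
        induction k with
        | zero => simp
        | succ k ih => rw [pow_succ', pow_succ', End.mul_apply, End.mul_apply, ih]; rfl
      rw [this]
      exact hC k
    have hlt : finrank ℝ W < finrank ℝ V := Submodule.finrank_lt htop
    have hpos : 0 < finrank ℝ W := Nat.pos_of_ne_zero (by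
      rw [Ne, Submodule.finrank_eq_zero]; exact hbot)
    have hadd := W.finrank_quotient_add_finrank
    obtain ⟨U1, hU1, H1⟩ := ih W (by omega) σ1 h1 (ε / 2) (by positivity)
    obtain ⟨U2, hU2, H2⟩ := ih (V ⧸ W) (by omega) σ2 h2 (ε / 2) (by positivity)
    refine ⟨U1 ∩ U2, hU1.inter hU2, fun S hS hSU => ?_⟩
    obtain ⟨X, i1, i2, e1, he1⟩ := H1 S hS (fun s hs => (hSU hs).1)
    obtain ⟨Y, j1, j2, e2, he2⟩ := H2 S hS (fun s hs => (hSU hs).2)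
    obtain ⟨p, hp⟩ := LinearMap.exists_leftInverse_of_injective W.subtype W.ker_subtype
    have hp' : ∀ w : W, p w = w := fun w => LinearMap.congr_fun hp w
    have := LinearEquiv.finiteDimensional e2
    have hK : ∀ s : G, ∃ K : ℝ, ∀ v, ‖e1 (p (σ s v - v) - (σ1 s (p v) - p v))‖ ≤
        K * ‖e2 (W.mkQ v)‖ := by
      intro s
      let D : V →ₗ[ℝ] W := p ∘ₗ (σ s - 1) - (σ1 s - 1) ∘ₗ p
      have hD : W ≤ LinearMap.ker D := by
        intro w hw
        rw [LinearMap.mem_ker]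
        have a1 : p w = ⟨w, hw⟩ := hp' ⟨w, hw⟩
        have a2 : p (σ s w) = ⟨σ s w, hW s w hw⟩ := hp' ⟨σ s w, hW s w hw⟩
        simp only [D, LinearMap.sub_apply, LinearMap.comp_apply, map_sub, a1, a2,
          Module.End.one_apply]
        apply Subtype.ext
        simp [σ1]
      let L : Y →ₗ[ℝ] X := e1.toLinearMap ∘ₗ (W.liftQ D hD) ∘ₗ e2.symm.toLinearMap
      refine ⟨‖LinearMap.toContinuousLinearMap L‖, fun v => ?_⟩
      have : e1 (p (σ s v - v) - (σ1 s (p v) - p v)) =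
          LinearMap.toContinuousLinearMap L (e2 (W.mkQ v)) := by
        simp [L, D]
      rw [this]
      exact ContinuousLinearMap.le_opNorm _ _
    choose K hK using hK
    obtain ⟨K0, hK0⟩ := (hS.image K).bddAbove
    set K1 := max K0 0
    set R := 2 * K1 / ε + 1 with hR
    have hRp : 0 < R := by positivity
    have hRK : K1 ≤ ε / 2 * R := by
      rw [hR]; field_simp; nlinarith
    let e0 : V →ₗ[ℝ] X × Y := (e1.toLinearMap ∘ₗ p).prod (R • (e2.toLinearMap ∘ₗ W.mkQ))
    have he0 : ∀ v, e0 v = (e1 (p v), R • e2 (W.mkQ v)) := fun v => rfl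
    have hinj : Function.Injective e0 := by
      rw [← LinearMap.ker_eq_bot, LinearMap.ker_eq_bot']
      intro v hv
      rw [he0, Prod.mk_eq_zero, smul_eq_zero] at hv
      obtain ⟨hv1, hv2⟩ := hv
      have hv3 : W.mkQ v = 0 := by
        rcases hv2 with h | h
        · exact absurd h hRp.ne'
        · simpa using h
      have hvW : v ∈ W := by simpa using hv3
      have := hp' ⟨v, hvW⟩
      have h0 : p v = 0 := by simpa using hv1
      simp only [h0] at this
      exact congrArg Subtype.val this.symm
    refine ⟨LinearMap.range e0, inferInstance, inferInstance, LinearEquiv.ofInjective e0 hinj, ?_⟩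
    intro s hs v
    show ‖e0 (σ s v - v)‖ ≤ ε * ‖e0 v‖
    have hn1 : ‖e1 (p v)‖ ≤ ‖e0 v‖ := by rw [he0]; exact norm_fst_le (e1 (p v), R • e2 (W.mkQ v))
    have hn2 : R * ‖e2 (W.mkQ v)‖ ≤ ‖e0 v‖ := by
      rw [he0]
      refine le_trans (le_of_eq ?_) (norm_snd_le (e1 (p v), R • e2 (W.mkQ v)))
      rw [norm_smul, Real.norm_of_nonneg hRp.le]
    have hKs : K s ≤ K1 := (hK0 (Set.mem_image_of_mem K hs)).trans (le_max_left _ _)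
    rw [he0 (σ s v - v)]
    apply norm_prod_le_iff.2
    constructor
    · have : e1 (p (σ s v - v)) = e1 (p (σ s v - v) - (σ1 s (p v) - p v)) + e1 (σ1 s (p v) - p v) := by
        rw [← map_add]; congr 1; abel
      simp only
      rw [this]
      refine (norm_add_le _ _).trans ?_
      have a1 := hK s v
      have a2 := he1 s hs (p v)
      have a3 : K s * ‖e2 (W.mkQ v)‖ ≤ ε / 2 * (R * ‖e2 (W.mkQ v)‖) := by
        rw [← mul_assoc]
        exact mul_le_mul_of_nonneg_right (hKs.trans hRK) (norm_nonneg _)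
      nlinarith
    · have a2 := he2 s hs (W.mkQ v)
      have : W.mkQ (σ s v - v) = σ2 s (W.mkQ v) - W.mkQ v := by rw [map_sub]; rfl
      simp only
      rw [norm_smul, Real.norm_of_nonneg hRp.le, this]
      have : R * ‖e2 (σ2 s (W.mkQ v) - W.mkQ v)‖ ≤ R * (ε / 2 * ‖e2 (W.mkQ v)‖) :=
        mul_le_mul_of_nonneg_left a2 hRp.le
      nlinarith [norm_nonneg (e0 v)]

open Module MeasureTheory
set_option linter.unusedSectionVars false

section
variable {G : Type*} [Group G] [TopologicalSpace G] [IsTopologicalGroup G] [LocallyCompactSpace G]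
  [T2Space G] [SecondCountableTopology G] [MeasurableSpace G] [BorelSpace G]
  (μ : Measure G) [μ.IsHaarMeasure]

lemma conj_measurePreserving (O : Set G) (hO : IsOpen O) (hOne : O.Nonempty)
    (hOc : IsCompact (closure O)) (hconj : ∀ g, ∀ h ∈ O, g * h * g⁻¹ ∈ O) (g : G) :
    MeasurePreserving (fun h => g * h * g⁻¹) μ μ := by
  have hcont : Continuous (fun h : G => g * h * g⁻¹) := by fun_prop
  have hH : (μ.map (MulAut.conj g : G ≃* G)).IsHaarMeasure :=
    MulEquiv.isHaarMeasure_map μ (MulAut.conj g) hcont (by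
      show Continuous fun h : G => g⁻¹ * h * g
      fun_prop)
  have hmap : μ.map (fun h => g * h * g⁻¹) = μ.map (MulAut.conj g : G ≃* G) := rfl
  refine ⟨hcont.measurable, ?_⟩
  rw [hmap]
  have h1 := Measure.isMulLeftInvariant_eq_smul (μ.map (MulAut.conj g : G ≃* G)) μ
  have hpre : (fun h => g * h * g⁻¹) ⁻¹' O = O := by
    ext h
    constructor
    · intro hh
      have := hconj g⁻¹ _ hh
      simpa [mul_assoc] using this
    · exact hconj g h
  have h2 : (μ.map (MulAut.conj g : G ≃* G)) O = μ O := by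
    rw [← hmap, Measure.map_apply hcont.measurable hO.measurableSet, hpre]
  have hpos : μ O ≠ 0 := (hO.measure_pos μ hOne).ne'
  have hfin : μ O ≠ ⊤ := ((measure_mono subset_closure).trans_lt hOc.measure_lt_top).ne
  rw [h1] at h2 ⊢
  rw [Measure.smul_apply] at h2
  generalize Measure.haarScalarFactor (μ.map (MulAut.conj g : G ≃* G)) μ = c at h2
  have hc : c = 1 := by
    have h3 : (c : ENNReal) * μ O = 1 * μ O := by rw [one_mul]; exact h2
    have := (ENNReal.mul_left_inj hpos hfin).1 h3
    exact_mod_cast this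
  rw [hc, one_smul]

variable {E : Type*} [NormedAddCommGroup E] [NormedSpace ℝ E] [FiniteDimensional ℝ E]
  (τ : G →* (E →L[ℝ] E))

lemma tau_integrableOn (hτ : Continuous τ) (O : Set G) (hOc : IsCompact (closure O)) : IntegrableOn τ O μ :=
  (hτ.continuousOn.integrableOn_compact hOc).mono_set subset_closure

lemma avg_commute (hτ : Continuous τ) (O : Set G) (hO : IsOpen O) (hOne : O.Nonempty)
    (hOc : IsCompact (closure O)) (hconj : ∀ g, ∀ h ∈ O, g * h * g⁻¹ ∈ O) (g : G) :
    τ g * (∫ h in O, τ h ∂μ) = (∫ h in O, τ h ∂μ) * τ g := by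
  have hIntg := tau_integrableOn μ τ hτ O hOc
  have hmp := conj_measurePreserving μ O hO hOne hOc hconj g
  have hemb : MeasurableEmbedding (fun h => g * h * g⁻¹) :=
    ((Homeomorph.mulLeft g).trans (Homeomorph.mulRight g⁻¹)).measurableEmbedding
  have h1 := hmp.setIntegral_preimage_emb hemb (fun h => τ h * τ g) O
  have hpre : (fun h => g * h * g⁻¹) ⁻¹' O = O := by
    ext h
    constructor
    · intro hh
      have := hconj g⁻¹ _ hh
      simpa [mul_assoc] using this
    · exact hconj g h
  rw [hpre] at h1
  have h2 : ∀ h, τ (g * h * g⁻¹) * τ g = τ g * τ h := by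
    intro h; rw [← map_mul, ← map_mul]; congr 1; group
  simp only [h2] at h1
  have h3 := ((ContinuousLinearMap.mul ℝ (E →L[ℝ] E)) (τ g)).integral_comp_comm hIntg
  have h4 := ((ContinuousLinearMap.mul ℝ (E →L[ℝ] E)).flip (τ g)).integral_comp_comm hIntg
  simp only [ContinuousLinearMap.mul_apply', ContinuousLinearMap.flip_apply] at h3 h4
  rw [← h3, ← h4, h1]

lemma trivial_of_avg_nilpotent (hτ : Continuous τ) (hpb : ∀ g, PB (τ g : E →ₗ[ℝ] E)) (O : Set G) (hO : IsOpen O)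
    (hOc : IsCompact (closure O)) (hgen : Subgroup.closure O = ⊤)
    (hnil : IsNilpotent ((∫ h in O, τ h ∂μ) - (μ.real O) • (1 : E →L[ℝ] E))) (g : G) :
    τ g = 1 := by
  have hIntg := tau_integrableOn μ τ hτ O hOc
  have hfin : μ O ≠ ⊤ := ((measure_mono subset_closure).trans_lt hOc.measure_lt_top).ne
  let tr : (E →L[ℝ] E) →L[ℝ] ℝ :=
    LinearMap.toContinuousLinearMap ((LinearMap.trace ℝ E) ∘ₗ ContinuousLinearMap.coeLM ℝ)
  have htr : ∀ a : E →L[ℝ] E, tr a = LinearMap.trace ℝ E (a : E →ₗ[ℝ] E) := fun a => rfl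
  have htr1 : tr 1 = finrank ℝ E := by
    rw [htr]; exact LinearMap.trace_one ℝ E
  have h0 : tr ((∫ h in O, τ h ∂μ) - (μ.real O) • (1 : E →L[ℝ] E)) = 0 := by
    obtain ⟨k, hk⟩ := hnil
    rw [htr]
    refine (LinearMap.isNilpotent_trace_of_isNilpotent ⟨k, ?_⟩).eq_zero
    rw [← ContinuousLinearMap.toLinearMap_pow, hk]; rfl
  have h1 := tr.integral_comp_comm hIntg
  rw [map_sub, map_smul, htr1, ← h1] at h0
  have hint2 : IntegrableOn (fun h => (finrank ℝ E : ℝ) - tr (τ h)) O μ :=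
    (integrableOn_const hfin).sub (tr.integrable_comp hIntg)
  have h2 : ∫ h in O, ((finrank ℝ E : ℝ) - tr (τ h)) ∂μ = 0 := by
    have hcst : Integrable (fun _ : G => (finrank ℝ E : ℝ)) (μ.restrict O) := integrableOn_const hfin
    rw [integral_sub hcst (tr.integrable_comp hIntg), setIntegral_const]
    simp only [smul_eq_mul] at h0 ⊢
    linarith
  rw [setIntegral_eq_zero_iff_of_nonneg_ae (Filter.Eventually.of_forall fun h => ?_) hint2] at h2
  · have h3 := Measure.eqOn_open_of_ae_eq h2 hO (by fun_prop) (by fun_prop)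
    have h4 : ∀ h ∈ O, τ h = 1 := by
      intro h hh
      have := h3 hh
      have h5 : LinearMap.trace ℝ E (τ h : E →ₗ[ℝ] E) = finrank ℝ E := by
        rw [← htr]; simp only [Pi.zero_apply] at this; linarith
      have := (pb_trace _ (hpb h)).2 h5
      exact ContinuousLinearMap.coe_injective this
    have : O ⊆ τ.ker := fun h hh => h4 h hh
    have h6 := (Subgroup.closure_le _).2 this
    rw [hgen] at h6
    exact h6 (Subgroup.mem_top g)
  · have := (abs_le.1 (pb_trace _ (hpb h)).1).2
    simp only [Pi.zero_apply, htr]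
    linarith

/-- restriction of a representation to an invariant submodule -/
noncomputable def subRep (F : Submodule ℝ E) (hF : ∀ g, ∀ x ∈ F, τ g x ∈ F) : G →* (F →L[ℝ] F) where
  toFun g := (τ g).restrict (hF g)
  map_one' := by ext; simp
  map_mul' a b := by ext; simp

lemma subRep_apply (F : Submodule ℝ E) (hF : ∀ g, ∀ x ∈ F, τ g x ∈ F) (g : G) (x : F) :
    (subRep τ F hF g x : E) = τ g x := rfl

lemma subRep_pb (F : Submodule ℝ E) (hF : ∀ g, ∀ x ∈ F, τ g x ∈ F) (g : G)
    (h : PB (τ g : E →ₗ[ℝ] E)) : PB (subRep τ F hF g : F →ₗ[ℝ] F) := by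
  intro f v
  obtain ⟨f', hf'⟩ := LinearMap.exists_extend f
  obtain ⟨C, hC⟩ := h f' v
  refine ⟨C, fun k => ?_⟩
  have : ∀ k : ℕ, ((((subRep τ F hF g : F →ₗ[ℝ] F)) ^ k) v : E) = ((τ g : E →ₗ[ℝ] E) ^ k) v := by
    intro k
    induction k with
    | zero => simp
    | succ k ih => rw [pow_succ', pow_succ', End.mul_apply, End.mul_apply, ← ih]; rfl
  rw [← hf', LinearMap.comp_apply, Submodule.subtype_apply, this]
  exact hC k

lemma subRep_continuous (hτ : Continuous τ) (F : Submodule ℝ E) (hF : ∀ g, ∀ x ∈ F, τ g x ∈ F) :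
    Continuous (subRep τ F hF) := by
  rw [continuous_clm_apply]
  intro x
  rw [Topology.IsInducing.subtypeVal.continuous_iff]
  exact (continuous_clm_apply.1 hτ) x

lemma reynolds (hτ : Continuous τ)
    (hpb : ∀ g, PB (τ g : E →ₗ[ℝ] E)) (O : Set G) (hO : IsOpen O) (hOne : O.Nonempty)
    (hOc : IsCompact (closure O)) (hconj : ∀ g, ∀ h ∈ O, g * h * g⁻¹ ∈ O)
    (hgen : Subgroup.closure O = ⊤)
    (l : E →L[ℝ] ℝ) (hl : ∀ g x, l (τ g x) = l x) (y : E) :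
    ∃ f : E, (∀ g, τ g f = f) ∧ l f = l y := by
  let μ : Measure G := Measure.haar
  have hIntg := tau_integrableOn μ τ hτ O hOc
  have hcomm := avg_commute μ τ hτ O hO hOne hOc hconj
  set C := ∫ h in O, τ h ∂μ with hC
  set T : E →L[ℝ] E := C - (μ.real O) • (1 : E →L[ℝ] E) with hT
  have hCx : ∀ x, C x = ∫ h in O, τ h x ∂μ := fun x =>
    ContinuousLinearMap.integral_apply hIntg x
  have hintx : ∀ x, IntegrableOn (fun h => τ h x) O μ := fun x =>
    hIntg.apply_continuousLinearMap x
  have hlT : ∀ x, l (T x) = 0 := by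
    intro x
    have : l (C x) = μ.real O * l x := by
      rw [hCx, ← l.integral_comp_comm (hintx x)]
      simp [hl]
    rw [hT, sub_apply, map_sub, this]
    simp
  have hTcomm : ∀ g, τ g * T = T * τ g := by
    intro g
    rw [hT, mul_sub, sub_mul, hcomm]
    simp
  obtain ⟨k, hk, hk1⟩ := (((T : E →ₗ[ℝ] E).eventually_isCompl_ker_pow_range_pow).and
    (Filter.eventually_ge_atTop 1)).exists
  set F := LinearMap.ker ((T : E →ₗ[ℝ] E) ^ k) with hF
  have hTk : ∀ x, ((T : E →ₗ[ℝ] E) ^ k) x = (T ^ k) x := by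
    intro x; rw [← ContinuousLinearMap.toLinearMap_pow]; rfl
  have hFinv : ∀ g, ∀ x ∈ F, τ g x ∈ F := by
    intro g x hx
    rw [hF, LinearMap.mem_ker, hTk] at hx ⊢
    have : T ^ k * τ g = τ g * T ^ k := by
      exact ((show Commute (τ g) T from hTcomm g).pow_right k).symm.eq
    have h2 := congrArg (fun a : E →L[ℝ] E => a x) this
    simp only [mul_apply_eq_comp] at h2
    rw [h2, hx, map_zero]
  have hy : y ∈ F ⊔ LinearMap.range ((T : E →ₗ[ℝ] E) ^ k) := by rw [hk.sup_eq_top]; trivial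
  obtain ⟨f, hf, r, ⟨z, hz⟩, hfr⟩ := Submodule.mem_sup.1 hy
  refine ⟨f, ?_, ?_⟩
  · have hintF := tau_integrableOn μ (subRep τ F hFinv) (subRep_continuous τ hτ F hFinv) O hOc
    have key := trivial_of_avg_nilpotent μ (subRep τ F hFinv) (subRep_continuous τ hτ F hFinv)
      (fun g => subRep_pb τ F hFinv g (hpb g)) O hO hOc hgen ?_
    · intro g
      have := congrArg (fun a : F →L[ℝ] F => ((a ⟨f, hf⟩ : F) : E)) (key g)
      simpa [subRep_apply] using this
    · set T' := (∫ h in O, subRep τ F hFinv h ∂μ) - (μ.real O) • (1 : F →L[ℝ] F)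
      have hT' : ∀ x : F, ((T' x : F) : E) = T x := by
        intro x
        have h1 : ((∫ h in O, subRep τ F hFinv h ∂μ) x) = ∫ h in O, subRep τ F hFinv h x ∂μ :=
          ContinuousLinearMap.integral_apply hintF x
        have h2 : (((∫ h in O, subRep τ F hFinv h x ∂μ) : F) : E) =
            ∫ h in O, τ h x ∂μ :=
          (F.subtypeL.integral_comp_comm (hintF.apply_continuousLinearMap x)).symm
        simp only [T', hT, sub_apply, h1, Submodule.coe_sub, h2, hCx]
        simp
      refine ⟨k, ?_⟩
      ext x
      have : ∀ m : ℕ, (((T' ^ m) x : F) : E) = (T ^ m) x := by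
        intro m
        induction m with
        | zero => simp
        | succ m ih => rw [pow_succ', pow_succ', mul_apply_eq_comp, mul_apply_eq_comp, hT', ih]
      rw [this k, ← hTk]
      exact x.2
  · rw [← hfr, map_add, ← hz, hTk]
    obtain ⟨m, rfl⟩ := Nat.exists_eq_add_of_le' hk1
    rw [pow_succ', mul_apply_eq_comp, hlT, add_zero]

end

open Module MeasureTheory
set_option linter.unusedSectionVars false

section
variable {G : Type*} [Group G] 
variable {V : Type*} [NormedAddCommGroup V] [NormedSpace ℝ V] [FiniteDimensional ℝ V]

lemma pb_of_norm {E : Type*} [NormedAddCommGroup E] [NormedSpace ℝ E] [FiniteDimensional ℝ E]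
    (a : E →L[ℝ] E) (h : ∃ C : ℝ, ∀ n : ℕ, ‖a ^ n‖ ≤ C) : PB (a : E →ₗ[ℝ] E) := by
  intro f v
  obtain ⟨C, hC⟩ := h
  refine ⟨‖LinearMap.toContinuousLinearMap f‖ * (C * ‖v‖), fun n => ?_⟩
  rw [← ContinuousLinearMap.toLinearMap_pow]
  have h1 := (LinearMap.toContinuousLinearMap f).le_opNorm ((a ^ n) v)
  have h2 := (a ^ n).le_opNorm v
  have h3 := mul_le_mul_of_nonneg_right (hC n) (norm_nonneg v)
  refine h1.trans ?_
  gcongr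
  exact h2.trans h3

/-- conjugation representation -/
noncomputable def conjRep (ρ : G →* (V →L[ℝ] V)) : G →* ((V →L[ℝ] V) →L[ℝ] (V →L[ℝ] V)) where
  toFun g := ContinuousLinearMap.mulLeftRight ℝ (V →L[ℝ] V) (ρ g) (ρ g⁻¹)
  map_one' := by ext1 a; simp
  map_mul' g h := by ext1 a; simp [mul_assoc]

lemma conjRep_apply (ρ : G →* (V →L[ℝ] V)) (g : G) (a : V →L[ℝ] V) :
    conjRep ρ g a = ρ g * a * ρ g⁻¹ := by
  simp [conjRep]

lemma conjRep_pb (ρ : G →* (V →L[ℝ] V)) (hb : ∀ g, ∃ C : ℝ, ∀ n : ℕ, ‖ρ g ^ n‖ ≤ C) (g : G) :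
    PB (conjRep ρ g : (V →L[ℝ] V) →ₗ[ℝ] (V →L[ℝ] V)) := by
  apply pb_of_norm
  obtain ⟨C, hC⟩ := hb g
  obtain ⟨D, hD⟩ := hb g⁻¹
  refine ⟨C * D, fun n => ?_⟩
  have hC0 : 0 ≤ C := (norm_nonneg _).trans (hC 0)
  have hD0 : 0 ≤ D := (norm_nonneg _).trans (hD 0)
  refine ContinuousLinearMap.opNorm_le_bound _ (by positivity) fun a => ?_
  rw [← map_pow, conjRep_apply, map_pow, ← inv_pow, map_pow]
  calc _ ≤ ‖ρ g ^ n‖ * ‖a‖ * ‖ρ g⁻¹ ^ n‖ := norm_mul₃_le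
    _ ≤ C * ‖a‖ * D := by gcongr; exact hC n; exact hD n
    _ = _ := by ring

/-- maps into `W` that are scalar on `W` -/
def scalarOn (W : Submodule ℝ V) : Submodule ℝ (V →L[ℝ] V) where
  carrier := {a | (∀ v, a v ∈ W) ∧ ∃ c : ℝ, ∀ w ∈ W, a w = c • w}
  zero_mem' := ⟨fun v => by simp, 0, fun w _ => by simp⟩
  add_mem' := by
    rintro a b ⟨ha, c, hc⟩ ⟨hb, d, hd⟩
    exact ⟨fun v => W.add_mem (ha v) (hb v), c + d, fun w hw => by
      rw [add_apply, hc w hw, hd w hw, add_smul]⟩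
  smul_mem' := by
    rintro r a ⟨ha, c, hc⟩
    exact ⟨fun v => W.smul_mem r (ha v), r * c, fun w hw => by
      rw [smul_apply, hc w hw, smul_smul]⟩

variable [TopologicalSpace G] [IsTopologicalGroup G] [LocallyCompactSpace G]
  [T2Space G] [SecondCountableTopology G]

lemma cr_of_gen (ρ : G →* (V →L[ℝ] V)) (hρ : Continuous ρ)
    (hb : ∀ g, ∃ C : ℝ, ∀ n : ℕ, ‖ρ g ^ n‖ ≤ C) (O : Set G) (hO : IsOpen O) (hOne : O.Nonempty)
    (hOc : IsCompact (closure O)) (hconj : ∀ g, ∀ h ∈ O, g * h * g⁻¹ ∈ O)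
    (hgen : Subgroup.closure O = ⊤) (W : Submodule ℝ V) (hW : ∀ g, ∀ w ∈ W, ρ g w ∈ W) :
    ∃ W' : Submodule ℝ V, (∀ g, ∀ w ∈ W', ρ g w ∈ W') ∧ IsCompl W W' := by
  let _ : MeasurableSpace G := borel G
  have : BorelSpace G := ⟨rfl⟩
  by_cases hbot : W = ⊥
  · exact ⟨⊤, fun _ _ _ => trivial, hbot ▸ isCompl_bot_top⟩
  obtain ⟨w0, hw0, hne⟩ := W.ne_bot_iff.1 hbot
  obtain ⟨w1, hw1⟩ := SeparatingDual.exists_eq_one (R := ℝ) hne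
  have hinv : ∀ g, ∀ a ∈ scalarOn W, conjRep ρ g a ∈ scalarOn W := by
    rintro g a ⟨ha, c, hc⟩
    refine ⟨fun v => ?_, c, fun w hw => ?_⟩
    · rw [conjRep_apply, mul_apply_eq_comp, mul_apply_eq_comp]
      exact hW g _ (ha _)
    · rw [conjRep_apply, mul_apply_eq_comp, mul_apply_eq_comp, hc _ (hW _ w hw), map_smul,
        ← mul_apply_eq_comp, ← map_mul, mul_inv_cancel, map_one, one_apply_eq_self]
  have hcont : Continuous (conjRep ρ) := by
    rw [continuous_clm_apply]
    intro a
    simp only [conjRep_apply]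
    have : Continuous fun g => ρ g⁻¹ := hρ.comp continuous_inv
    fun_prop
  let l0 : (V →L[ℝ] V) →L[ℝ] ℝ := w1 ∘L ContinuousLinearMap.apply ℝ V w0
  have hl0 : ∀ a, l0 a = w1 (a w0) := fun a => rfl
  let l : scalarOn W →L[ℝ] ℝ := l0 ∘L (scalarOn W).subtypeL
  have hl : ∀ a : scalarOn W, l a = w1 ((a : V →L[ℝ] V) w0) := fun a => rfl
  -- a projection onto `W`
  obtain ⟨p, hp⟩ := W.exists_isCompl
  let y0 : V →L[ℝ] V := LinearMap.toContinuousLinearMap (W.subtype ∘ₗ W.projectionOnto p hp)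
  have hy0 : ∀ v, y0 v = (W.projectionOnto p hp v : V) := fun v => rfl
  have hy0W : ∀ w ∈ W, y0 w = w := by
    intro w hw
    rw [hy0]
    exact congrArg Subtype.val (Submodule.projectionOnto_apply_left hp ⟨w, hw⟩)
  have hy : y0 ∈ scalarOn W :=
    ⟨fun v => by rw [hy0]; exact Subtype.property _, 1, fun w hw => by rw [hy0W w hw, one_smul]⟩
  obtain ⟨f, hf, hlf⟩ := reynolds (subRep (conjRep ρ) (scalarOn W) hinv)
    (subRep_continuous _ hcont _ _) (fun g => subRep_pb _ _ _ _ (conjRep_pb ρ hb g))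
    O hO hOne hOc hconj hgen l (by
      rintro g ⟨a, ha⟩
      rw [hl, hl, subRep_apply]
      obtain ⟨ha, c, hc⟩ := ha
      obtain ⟨-, d, hd⟩ := hinv g a ⟨ha, c, hc⟩
      simp only
      rw [conjRep_apply, mul_apply_eq_comp, mul_apply_eq_comp, hc _ (hW _ w0 hw0), map_smul,
        ← mul_apply_eq_comp, ← map_mul, mul_inv_cancel, map_one, one_apply_eq_self, hc w0 hw0])
    ⟨y0, hy⟩
  obtain ⟨f, hfW, c, hc⟩ := f
  have hc1 : c = 1 := by
    rw [hl, hl] at hlf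
    simp only at hlf
    rw [hc w0 hw0, hy0W w0 hw0, map_smul, hw1, smul_eq_mul, mul_one] at hlf
    exact hlf
  subst hc1
  have hcomm : ∀ g, ρ g * f = f * ρ g := by
    intro g
    have h1 : ρ g * f * ρ g⁻¹ = f := by
      have := congrArg Subtype.val (hf g)
      rw [subRep_apply, conjRep_apply] at this
      exact this
    calc ρ g * f = ρ g * f * (ρ g⁻¹ * ρ g) := by
          rw [← map_mul, inv_mul_cancel, map_one, mul_one]
      _ = f * ρ g := by rw [← mul_assoc, h1]
  refine ⟨LinearMap.ker (f : V →ₗ[ℝ] V), fun g w hw => ?_, ?_⟩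
  · have hw' : f w = 0 := hw
    show f (ρ g w) = 0
    rw [← mul_apply_eq_comp, ← hcomm, mul_apply_eq_comp, hw', map_zero]
  · refine ⟨?_, ?_⟩
    · rw [Submodule.disjoint_def]
      intro x hx hx'
      have h1 : f x = 0 := hx'
      rw [hc x hx, one_smul] at h1
      exact h1
    · rw [codisjoint_iff, eq_top_iff]
      intro v _
      refine Submodule.mem_sup.2 ⟨f v, hfW v, v - f v, ?_, by abel⟩
      show f (v - f v) = 0
      rw [map_sub, hc _ (hfW v), one_smul, sub_self]

end

section
variable {G : Type*} [Group G] 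
variable {V : Type*} [NormedAddCommGroup V] [NormedSpace ℝ V] [FiniteDimensional ℝ V]

lemma norm_bdd_of_cr (ρ : G →* (V →L[ℝ] V))
    (hb : ∀ g, ∃ C : ℝ, ∀ n : ℕ, ‖ρ g ^ n‖ ≤ C)
    (hcr : ∀ W : Submodule ℝ V, (∀ g, ∀ w ∈ W, ρ g w ∈ W) →
      ∃ W' : Submodule ℝ V, (∀ g, ∀ w ∈ W', ρ g w ∈ W') ∧ IsCompl W W') :
    ∃ C : ℝ, ∀ g, ‖ρ g‖ ≤ C := by
  let σ : G →* (V →ₗ[ℝ] V) :=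
    (ContinuousLinearMap.toLinearMapRingHom : (V →L[ℝ] V) →+* (V →ₗ[ℝ] V)).toMonoidHom.comp ρ
  have key := bounded_of_cr σ hcr (finrank ℝ V)
    (fun g => (pb_trace _ (pb_of_norm _ (hb g))).1)
  apply norm_bdd_of_dual_bdd
  intro f
  obtain ⟨C, hC⟩ := key (f ∘ₗ (LinearMap.toContinuousLinearMap : (V →ₗ[ℝ] V) ≃ₗ[ℝ] _).toLinearMap)
  exact ⟨C, fun g => by
    have := hC g
    rw [LinearMap.comp_apply] at this
    exact this⟩
end

open Module MeasureTheory
set_option linter.unusedSectionVars false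

section
variable {V : Type*} [NormedAddCommGroup V] [NormedSpace ℝ V] [FiniteDimensional ℝ V]

lemma units_compact (R : ℝ) :
    IsCompact {u : (V →L[ℝ] V)ˣ | ‖(u : V →L[ℝ] V)‖ ≤ R ∧ ‖((u⁻¹ : (V →L[ℝ] V)ˣ) : V →L[ℝ] V)‖ ≤ R} := by
  have : ProperSpace (V →L[ℝ] V) := FiniteDimensional.proper ℝ _
  have hc : IsCompact ((Metric.closedBall (0 : V →L[ℝ] V) R) ×ˢ
      (MulOpposite.op '' (Metric.closedBall (0 : V →L[ℝ] V) R))) :=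
    (isCompact_closedBall _ _).prod ((isCompact_closedBall _ _).image MulOpposite.continuous_op)
  have h := (Units.isClosedEmbedding_embedProduct (α := V →L[ℝ] V)).isCompact_preimage hc
  convert h using 1
  ext u
  simp [Units.embedProduct]

lemma units_lc : LocallyCompactSpace (V →L[ℝ] V)ˣ := by
  have : ProperSpace (V →L[ℝ] V) := FiniteDimensional.proper ℝ _
  exact Units.isOpenEmbedding_val.locallyCompactSpace

lemma units_sc : SecondCountableTopology (V →L[ℝ] V)ˣ := by
  have : ProperSpace (V →L[ℝ] V) := FiniteDimensional.proper ℝ _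
  exact Units.isOpenEmbedding_val.isEmbedding.secondCountableTopology

lemma zpow_bdd_of_ell (g : (V →L[ℝ] V)ˣ) (h : IsCompact (closure (Set.range fun n : ℤ => g ^ n))) :
    ∃ C : ℝ, ∀ n : ℤ, ‖((g ^ n : (V →L[ℝ] V)ˣ) : V →L[ℝ] V)‖ ≤ C := by
  obtain ⟨C, hC⟩ := (h.image Units.continuous_val).isBounded.exists_norm_le
  exact ⟨C, fun n => hC _ ⟨_, subset_closure ⟨n, rfl⟩, rfl⟩⟩

lemma cr_closure (U O : Set (V →L[ℝ] V)ˣ) (hU : IsOpen U)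
    (hM : IsClosed (Subgroup.closure O : Set (V →L[ℝ] V)ˣ))
    (hUO : O = U ∩ (Subgroup.closure O : Set (V →L[ℝ] V)ˣ)) (hne : O.Nonempty)
    (hpb : ∀ g ∈ Subgroup.closure O, ∃ C : ℝ, ∀ n : ℕ, ‖(g : V →L[ℝ] V) ^ n‖ ≤ C)
    (R : ℝ) (hR : ∀ g ∈ O, ‖(g : V →L[ℝ] V)‖ ≤ R ∧ ‖((g⁻¹ : (V →L[ℝ] V)ˣ) : V →L[ℝ] V)‖ ≤ R)
    (hconj : ∀ g ∈ Subgroup.closure O, ∀ h ∈ O, g * h * g⁻¹ ∈ O)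
    (W : Submodule ℝ V) (hW : ∀ g ∈ Subgroup.closure O, ∀ w ∈ W, (g : V →L[ℝ] V) w ∈ W) :
    ∃ W' : Submodule ℝ V, (∀ g ∈ Subgroup.closure O, ∀ w ∈ W', (g : V →L[ℝ] V) w ∈ W') ∧
      IsCompl W W' := by
  have := units_lc (V := V)
  have := units_sc (V := V)
  have hemb : Topology.IsClosedEmbedding (Subtype.val : Subgroup.closure O → (V →L[ℝ] V)ˣ) :=
    hM.isClosedEmbedding_subtypeVal
  have : LocallyCompactSpace (Subgroup.closure O) := hemb.locallyCompactSpace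
  have : SecondCountableTopology (Subgroup.closure O) := hemb.isEmbedding.secondCountableTopology
  let ρ : Subgroup.closure O →* (V →L[ℝ] V) :=
    (Units.coeHom (V →L[ℝ] V)).comp (Subgroup.closure O).subtype
  have hρ : Continuous ρ := Units.continuous_val.comp continuous_subtype_val
  have hpre : ((↑) ⁻¹' O : Set (Subgroup.closure O)) = (↑) ⁻¹' U := by
    ext x
    constructor
    · intro hx
      exact (hUO.le hx).1
    · intro hx
      exact hUO.ge ⟨hx, x.2⟩
  obtain ⟨W', h1, h2⟩ := cr_of_gen ρ hρ (fun g => hpb g g.2) (Subtype.val ⁻¹' O)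
    (by rw [hpre]; exact hU.preimage continuous_subtype_val)
    (by
      obtain ⟨x, hx⟩ := hne
      exact ⟨⟨x, Subgroup.subset_closure hx⟩, hx⟩)
    (by
      have hK := hemb.isCompact_preimage (units_compact (V := V) R)
      refine hK.of_isClosed_subset isClosed_closure (closure_minimal ?_ hK.isClosed)
      intro x hx
      exact hR _ hx)
    (fun g h hh => hconj g g.2 h hh)
    (Subgroup.closure_closure_coe_preimage) W (fun g => hW g g.2)
  exact ⟨W', fun g hg => h1 ⟨g, hg⟩, h2⟩

lemma bdd_of_cr_subgroup (M : Subgroup (V →L[ℝ] V)ˣ)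
    (hpb : ∀ g ∈ M, ∃ C : ℝ, ∀ n : ℕ, ‖(g : V →L[ℝ] V) ^ n‖ ≤ C)
    (hcr : ∀ W : Submodule ℝ V, (∀ g ∈ M, ∀ w ∈ W, (g : V →L[ℝ] V) w ∈ W) →
     ∃ W' : Submodule ℝ V, (∀ g ∈ M, ∀ w ∈ W', (g : V →L[ℝ] V) w ∈ W') ∧ IsCompl W W') :
    ∃ C : ℝ, ∀ g ∈ M, ‖(g : V →L[ℝ] V)‖ ≤ C := by
  obtain ⟨C, hC⟩ := norm_bdd_of_cr ((Units.coeHom (V →L[ℝ] V)).comp M.subtype)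
    (fun g => hpb g g.2) (by
      intro W hW
      obtain ⟨W', h1, h2⟩ := hcr W (fun g hg => hW ⟨g, hg⟩)
      exact ⟨W', fun g => h1 g g.2, h2⟩)
  exact ⟨C, fun g hg => hC ⟨g, hg⟩⟩
end

open Module MeasureTheory
set_option linter.unusedSectionVars false

section
variable {V : Type*} [NormedAddCommGroup V] [NormedSpace ℝ V] [FiniteDimensional ℝ V]

/-- the trace as a continuous functional -/
noncomputable def ctr : (V →L[ℝ] V) →L[ℝ] ℝ :=
  LinearMap.toContinuousLinearMap ((LinearMap.trace ℝ V) ∘ₗ ContinuousLinearMap.coeLM ℝ)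

lemma ctr_apply (a : V →L[ℝ] V) : ctr a = LinearMap.trace ℝ V (a : V →ₗ[ℝ] V) := rfl

lemma ctr_conj (s h : (V →L[ℝ] V)ˣ) :
    ctr (((s * h * s⁻¹ : (V →L[ℝ] V)ˣ)) : V →L[ℝ] V) = ctr (h : V →L[ℝ] V) := by
  have h2 : ∀ a b : V →L[ℝ] V, ctr (a * b) = ctr (b * a) := fun a b =>
    LinearMap.trace_mul_comm ℝ (a : V →ₗ[ℝ] V) (b : V →ₗ[ℝ] V)
  rw [Units.val_mul, h2, ← Units.val_mul]
  congr 2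
  group

/-- gauge -/
def near (r : ℝ) (h : (V →L[ℝ] V)ˣ) : Prop :=
  ‖(h : V →L[ℝ] V) - 1‖ < r ∧ ‖((h⁻¹ : (V →L[ℝ] V)ˣ) : V →L[ℝ] V) - 1‖ < r

lemma near.inv {r : ℝ} {h : (V →L[ℝ] V)ˣ} (hh : near r h) : near r h⁻¹ :=
  ⟨hh.2, by rw [inv_inv]; exact hh.1⟩

lemma isOpen_near (r : ℝ) : IsOpen {h : (V →L[ℝ] V)ˣ | near r h} := by
  have h1 : Continuous fun h : (V →L[ℝ] V)ˣ => ‖(h : V →L[ℝ] V) - 1‖ :=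
    (Units.continuous_val.sub continuous_const).norm
  have h2 : Continuous fun h : (V →L[ℝ] V)ˣ => ‖((h⁻¹ : (V →L[ℝ] V)ˣ) : V →L[ℝ] V) - 1‖ :=
    ((Units.continuous_val.comp continuous_inv).sub continuous_const).norm
  exact (isOpen_lt h1 continuous_const).inter (isOpen_lt h2 continuous_const)

lemma norm_one_le : ‖(1 : V →L[ℝ] V)‖ ≤ 1 := ContinuousLinearMap.norm_id_le

lemma norm_le_of_sub_one {a : V →L[ℝ] V} {r : ℝ} (h : ‖a - 1‖ ≤ r) : ‖a‖ ≤ r + 1 := by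
  calc ‖a‖ = ‖(a - 1) + 1‖ := by rw [sub_add_cancel]
    _ ≤ ‖a - 1‖ + ‖(1 : V →L[ℝ] V)‖ := norm_add_le _ _
    _ ≤ r + 1 := add_le_add h norm_one_le

lemma conj_sub_one_le (s h : (V →L[ℝ] V)ˣ) (B r : ℝ) (h1 : ‖(s : V →L[ℝ] V)‖ ≤ B)
    (h2 : ‖((s⁻¹ : (V →L[ℝ] V)ˣ) : V →L[ℝ] V)‖ ≤ B) (h3 : ‖(h : V →L[ℝ] V) - 1‖ ≤ r) :
    ‖((s * h * s⁻¹ : (V →L[ℝ] V)ˣ) : V →L[ℝ] V) - 1‖ ≤ B * r * B := by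
  have hB : 0 ≤ B := (norm_nonneg _).trans h1
  have hr : 0 ≤ r := (norm_nonneg _).trans h3
  have : ((s * h * s⁻¹ : (V →L[ℝ] V)ˣ) : V →L[ℝ] V) - 1 =
      s * ((h : V →L[ℝ] V) - 1) * ((s⁻¹ : (V →L[ℝ] V)ˣ) : V →L[ℝ] V) := by
    rw [mul_sub, sub_mul, mul_one, Units.mul_inv, Units.val_mul, Units.val_mul]
  rw [this]
  refine norm_mul₃_le.trans ?_
  gcongr

lemma small_subgroup (H : Subgroup (V →L[ℝ] V)ˣ) (hH : IsClosed (H : Set (V →L[ℝ] V)ˣ))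
    (hpb : ∀ g ∈ H, ∃ C : ℝ, ∀ n : ℕ, ‖(g : V →L[ℝ] V) ^ n‖ ≤ C)
    (S : Set (V →L[ℝ] V)ˣ) (hS : S.Finite) (hSH : S ⊆ H) :
    ∃ M : Subgroup (V →L[ℝ] V)ˣ, M ≤ H ∧ (∃ C : ℝ, ∀ g ∈ M, ‖(g : V →L[ℝ] V)‖ ≤ C) ∧
      (∀ s ∈ S, ∀ m ∈ M, s * m * s⁻¹ ∈ M) ∧ ∃ δ : ℝ, 0 < δ ∧ ∀ h ∈ H, near δ h → h ∈ M := by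
  obtain ⟨B1, hB1⟩ := (hS.image fun s : (V →L[ℝ] V)ˣ => ‖(s : V →L[ℝ] V)‖).bddAbove
  obtain ⟨B2, hB2⟩ := (hS.image fun s : (V →L[ℝ] V)ˣ => ‖((s⁻¹ : (V →L[ℝ] V)ˣ) : V →L[ℝ] V)‖).bddAbove
  set B := max 2 (max B1 B2) with hB
  set R := B * (1 / 2) * B with hR
  have hBS : ∀ s, s ∈ S ∨ near (1 / 2) s →
      ‖(s : V →L[ℝ] V)‖ ≤ B ∧ ‖((s⁻¹ : (V →L[ℝ] V)ˣ) : V →L[ℝ] V)‖ ≤ B := by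
    rintro s (hs | hs)
    · exact ⟨(hB1 ⟨s, hs, rfl⟩).trans ((le_max_left _ _).trans (le_max_right _ _)),
        (hB2 ⟨s, hs, rfl⟩).trans ((le_max_right _ _).trans (le_max_right _ _))⟩
    · have h2 : (1 / 2 + 1 : ℝ) ≤ B := le_trans (by norm_num) (le_max_left _ _)
      exact ⟨(norm_le_of_sub_one hs.1.le).trans h2, (norm_le_of_sub_one hs.2.le).trans h2⟩
  set n : ℝ := (finrank ℝ V : ℝ) with hn
  have hctr1 : ctr (1 : V →L[ℝ] V) = n := LinearMap.trace_one ℝ V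
  let K : Set (V →L[ℝ] V)ˣ := {h | h ∈ H ∧ (‖(h : V →L[ℝ] V) - 1‖ ≤ R ∧
    ‖((h⁻¹ : (V →L[ℝ] V)ˣ) : V →L[ℝ] V) - 1‖ ≤ R) ∧ ¬ near (1 / 2) h}
  have hKc : IsCompact K := by
    refine (units_compact (V := V) (R + 1)).of_isClosed_subset ?_ ?_
    · refine hH.inter (IsClosed.inter ?_ (isOpen_near _).isClosed_compl)
      exact (isClosed_le (Units.continuous_val.sub continuous_const).norm continuous_const).inter
        (isClosed_le ((Units.continuous_val.comp continuous_inv).sub continuous_const).norm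
          continuous_const)
    · rintro h ⟨-, ⟨h1, h2⟩, -⟩
      exact ⟨norm_le_of_sub_one h1, norm_le_of_sub_one h2⟩
  have hctc : Continuous fun h : (V →L[ℝ] V)ˣ => ctr (h : V →L[ℝ] V) :=
    ctr.continuous.comp Units.continuous_val
  have hone : near (1 / 2) (1 : (V →L[ℝ] V)ˣ) := by simp [near]
  have hε : ∃ ε : ℝ, 0 < ε ∧ ∀ h ∈ K, ctr (h : V →L[ℝ] V) ≤ n - ε := by
    rcases K.eq_empty_or_nonempty with hK | hK
    · exact ⟨1, one_pos, by simp [hK]⟩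
    · obtain ⟨x, hx, hmax⟩ := hKc.exists_isMaxOn hK hctc.continuousOn
      have hp := pb_trace _ (pb_of_norm _ (hpb x hx.1))
      have h1 : ctr (x : V →L[ℝ] V) ≤ n := (abs_le.1 hp.1).2
      have h2 : ctr (x : V →L[ℝ] V) ≠ n := by
        intro h
        have h3 := hp.2 h
        have h4 : (x : V →L[ℝ] V) = 1 := ContinuousLinearMap.coe_injective h3
        have h5 : x = 1 := Units.ext h4
        exact hx.2.2 (h5 ▸ hone)
      refine ⟨n - ctr (x : V →L[ℝ] V), by
        have := lt_of_le_of_ne h1 h2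
        linarith, fun h hh => ?_⟩
      have : ctr (h : V →L[ℝ] V) ≤ ctr (x : V →L[ℝ] V) := hmax hh
      linarith
  obtain ⟨ε, hε, hKε⟩ := hε
  let U : Set (V →L[ℝ] V)ˣ := {h | near (1 / 2) h ∧ n - ε < ctr (h : V →L[ℝ] V)}
  have hU : IsOpen U := (isOpen_near _).inter (isOpen_lt continuous_const hctc)
  have h1U : (1 : (V →L[ℝ] V)ˣ) ∈ U := ⟨hone, by
    rw [Units.val_one, hctr1]; linarith⟩
  let O : Set (V →L[ℝ] V)ˣ := U ∩ H
  have hconj : ∀ s ∈ H, s ∈ S ∨ near (1 / 2) s → ∀ h ∈ O, s * h * s⁻¹ ∈ O := by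
    rintro s hsH hs h ⟨⟨hh1, hh2⟩, hhH⟩
    have hmem : s * h * s⁻¹ ∈ H := H.mul_mem (H.mul_mem hsH hhH) (H.inv_mem hsH)
    obtain ⟨b1, b2⟩ := hBS s hs
    have e1 := conj_sub_one_le s h B (1 / 2) b1 b2 hh1.1.le
    have e2 := conj_sub_one_le s h⁻¹ B (1 / 2) b1 b2 hh1.2.le
    have e3 : (s * h * s⁻¹)⁻¹ = s * h⁻¹ * s⁻¹ := by group
    refine ⟨⟨?_, by rw [ctr_conj]; exact hh2⟩, hmem⟩
    by_contra hcon
    have := hKε (s * h * s⁻¹) ⟨hmem, ⟨e1, by rw [e3]; exact e2⟩, hcon⟩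
    rw [ctr_conj] at this
    linarith
  have hMH : Subgroup.closure O ≤ H := (Subgroup.closure_le _).2 Set.inter_subset_right
  have hconjM : ∀ g ∈ Subgroup.closure O,
      (∀ h ∈ O, g * h * g⁻¹ ∈ O) ∧ (∀ h ∈ O, g⁻¹ * h * g ∈ O) := by
    intro g hg
    induction hg using Subgroup.closure_induction with
    | mem x hx =>
      refine ⟨hconj x hx.2 (Or.inr hx.1.1), fun h hh => ?_⟩
      have := hconj x⁻¹ (H.inv_mem hx.2) (Or.inr hx.1.1.inv) h hh
      rwa [inv_inv] at this
    | one => simp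
    | mul x y _ _ hx hy =>
      refine ⟨fun h hh => ?_, fun h hh => ?_⟩
      · have := hx.1 _ (hy.1 h hh)
        convert this using 1; group
      · have := hy.2 _ (hx.2 h hh)
        convert this using 1; group
    | inv x _ hx =>
      refine ⟨fun h hh => ?_, fun h hh => ?_⟩
      · rw [inv_inv]; exact hx.2 h hh
      · rw [inv_inv]; exact hx.1 h hh
  have hMcl : IsClosed (Subgroup.closure O : Set (V →L[ℝ] V)ˣ) := by
    refine isClosed_of_closure_subset fun x hx => ?_
    have hxH : x ∈ H := (closure_minimal hMH hH) hx
    have hop : IsOpen {y | x⁻¹ * y ∈ U} := hU.preimage (continuous_const.mul continuous_id)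
    obtain ⟨y, hy1, hy2⟩ := mem_closure_iff.1 hx _ hop (by
      show x⁻¹ * x ∈ U
      rw [inv_mul_cancel]; exact h1U)
    have h3 : x⁻¹ * y ∈ Subgroup.closure O :=
      Subgroup.subset_closure ⟨hy1, H.mul_mem (H.inv_mem hxH) (hMH hy2)⟩
    have h4 := Subgroup.mul_mem _ hy2 (Subgroup.inv_mem _ h3)
    have h5 : y * (x⁻¹ * y)⁻¹ = x := by group
    rwa [h5] at h4
  have hpbM : ∀ g ∈ Subgroup.closure O, ∃ C : ℝ, ∀ n : ℕ, ‖(g : V →L[ℝ] V) ^ n‖ ≤ C :=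
    fun g hg => hpb g (hMH hg)
  refine ⟨Subgroup.closure O, hMH, bdd_of_cr_subgroup _ hpbM ?_, ?_, ?_⟩
  · refine cr_closure U O hU hMcl ?_ ⟨1, h1U, H.one_mem⟩ hpbM (1 / 2 + 1) ?_
      (fun g hg => (hconjM g hg).1)
    · exact Set.Subset.antisymm (fun x hx => ⟨hx.1, Subgroup.subset_closure hx⟩)
        (fun x hx => ⟨hx.1, hMH hx.2⟩)
    · rintro g ⟨⟨hg, -⟩, -⟩
      exact ⟨norm_le_of_sub_one hg.1.le, norm_le_of_sub_one hg.2.le⟩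
  · intro s hs m hm
    induction hm using Subgroup.closure_induction with
    | mem x hx => exact Subgroup.subset_closure (hconj s (hSH hs) (Or.inl hs) x hx)
    | one => simp
    | mul x y _ _ hx hy =>
      have := Subgroup.mul_mem _ hx hy
      convert this using 1; group
    | inv x _ hx =>
      have := Subgroup.inv_mem _ hx
      convert this using 1; group
  · have hev : ∀ᶠ a in nhds (1 : V →L[ℝ] V), n - ε < ctr a :=
      ctr.continuous.continuousAt.eventually (lt_mem_nhds (by rw [hctr1]; linarith))
    obtain ⟨δ, hδ, hball⟩ := Metric.eventually_nhds_iff.1 hev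
    refine ⟨min δ (1 / 2), by positivity, fun h hh hn => Subgroup.subset_closure ⟨⟨⟨?_, ?_⟩, ?_⟩, hh⟩⟩
    · exact hn.1.trans_le (min_le_right _ _)
    · exact hn.2.trans_le (min_le_right _ _)
    · apply hball
      rw [dist_eq_norm]
      exact hn.1.trans_le (min_le_left _ _)
end

open Module MeasureTheory
set_option linter.unusedSectionVars false

/-- iterated commutators -/
def iterComm {G : Type*} [Group G] (S : Set G) : ℕ → Set G
  | 0 => S
  | j + 1 => {z | ∃ s ∈ S, ∃ x ∈ iterComm S j, z = s * x * s⁻¹ * x⁻¹}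

lemma iterComm_finite {G : Type*} [Group G] (S : Set G) (hS : S.Finite) (j : ℕ) :
    (iterComm S j).Finite := by
  induction j with
  | zero => exact hS
  | succ j ih =>
    refine (hS.image2 (fun s x => s * x * s⁻¹ * x⁻¹) ih).subset ?_
    rintro z ⟨s, hs, x, hx, rfl⟩
    exact ⟨s, hs, x, hx, rfl⟩

lemma iterComm_sub {G : Type*} [Group G] (S : Set G) (j : ℕ) :
    iterComm S j ⊆ Subgroup.closure S := by
  induction j with
  | zero => exact Subgroup.subset_closure
  | succ j ih =>
    rintro z ⟨s, hs, x, hx, rfl⟩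
    have h1 := Subgroup.subset_closure hs
    have h2 := ih hx
    exact mul_mem (mul_mem (mul_mem h1 h2) (inv_mem h1)) (inv_mem h2)

section
variable {V : Type*} [NormedAddCommGroup V] [NormedSpace ℝ V] [FiniteDimensional ℝ V]

lemma comm_small_aux (s y : (V →L[ℝ] V)ˣ) (t : ℝ) (ht : t ≤ 1 / 8)
    (hs1 : ‖(s : V →L[ℝ] V) - 1‖ ≤ 1 / 8) (hs2 : ‖((s⁻¹ : (V →L[ℝ] V)ˣ) : V →L[ℝ] V) - 1‖ ≤ 1 / 8)
    (hy1 : ‖(y : V →L[ℝ] V) - 1‖ ≤ t) (hy2 : ‖((y⁻¹ : (V →L[ℝ] V)ˣ) : V →L[ℝ] V) - 1‖ ≤ t) :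
    ‖((s * y * s⁻¹ * y⁻¹ : (V →L[ℝ] V)ˣ) : V →L[ℝ] V) - 1‖ ≤ t * (1 / 2) ∧
    ‖(((s * y * s⁻¹ * y⁻¹)⁻¹ : (V →L[ℝ] V)ˣ) : V →L[ℝ] V) - 1‖ ≤ t * (1 / 2) := by
  have ht0 : 0 ≤ t := (norm_nonneg _).trans hy1
  have bs := norm_le_of_sub_one hs2
  have bY : ‖((y⁻¹ : (V →L[ℝ] V)ˣ) : V →L[ℝ] V)‖ ≤ 1 / 8 + 1 := norm_le_of_sub_one (hy2.trans ht)
  set D := ((s : V →L[ℝ] V) - 1) * ((y : V →L[ℝ] V) - 1) -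
    ((y : V →L[ℝ] V) - 1) * ((s : V →L[ℝ] V) - 1) with hD
  have hDn : ‖D‖ ≤ t / 4 := by
    refine (norm_sub_le _ _).trans ?_
    have h1 := (norm_mul_le ((s : V →L[ℝ] V) - 1) ((y : V →L[ℝ] V) - 1)).trans
      (mul_le_mul hs1 hy1 (norm_nonneg _) (by norm_num))
    have h2 := (norm_mul_le ((y : V →L[ℝ] V) - 1) ((s : V →L[ℝ] V) - 1)).trans
      (mul_le_mul hy1 hs1 (norm_nonneg _) ht0)
    linarith
  have hD2 : D = s * y - y * s := by rw [hD]; noncomm_ring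
  have key : ∀ a b : (V →L[ℝ] V)ˣ, ‖((a⁻¹ : (V →L[ℝ] V)ˣ) : V →L[ℝ] V)‖ ≤ 1 / 8 + 1 →
      ‖((b⁻¹ : (V →L[ℝ] V)ˣ) : V →L[ℝ] V)‖ ≤ 1 / 8 + 1 →
      ‖((a : V →L[ℝ] V) * b - b * a)‖ ≤ t / 4 →
      ‖((a * b * a⁻¹ * b⁻¹ : (V →L[ℝ] V)ˣ) : V →L[ℝ] V) - 1‖ ≤ t * (1 / 2) := by
    intro a b ha hb hab
    have e : ((a * b * a⁻¹ * b⁻¹ : (V →L[ℝ] V)ˣ) : V →L[ℝ] V) - 1 =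
        ((a : V →L[ℝ] V) * b - b * a) * ((a⁻¹ : (V →L[ℝ] V)ˣ) : V →L[ℝ] V) *
          ((b⁻¹ : (V →L[ℝ] V)ˣ) : V →L[ℝ] V) := by
      rw [sub_mul, sub_mul, Units.mul_inv_cancel_right, Units.mul_inv]
      simp only [Units.val_mul]
    rw [e]
    refine norm_mul₃_le.trans ?_
    calc _ ≤ t / 4 * (1 / 8 + 1) * (1 / 8 + 1) := by gcongr
      _ ≤ t * (1 / 2) := by nlinarith
  refine ⟨key s y bs bY (by rw [← hD2]; exact hDn), ?_⟩
  have : (s * y * s⁻¹ * y⁻¹)⁻¹ = y * s * y⁻¹ * s⁻¹ := by group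
  rw [this]
  exact key y s bY bs (by rw [← norm_neg, neg_sub, ← hD2]; exact hDn)

lemma inv_small (s : (V →L[ℝ] V)ˣ) (hs : ‖(s : V →L[ℝ] V) - 1‖ ≤ 1 / 16) :
    ‖((s⁻¹ : (V →L[ℝ] V)ˣ) : V →L[ℝ] V) - 1‖ ≤ 1 / 8 := by
  set b := ((s⁻¹ : (V →L[ℝ] V)ˣ) : V →L[ℝ] V) with hb
  have h1 : b - 1 = -(b * ((s : V →L[ℝ] V) - 1)) := by
    rw [mul_sub, hb, Units.inv_mul, mul_one, neg_sub]
  have h2 : ‖b‖ ≤ ‖b - 1‖ + 1 := norm_le_of_sub_one le_rfl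
  have h3 : ‖b - 1‖ ≤ ‖b‖ * (1 / 16) := by
    conv_lhs => rw [h1, norm_neg]
    exact (norm_mul_le _ _).trans (by gcongr)
  linarith

lemma iterComm_near {X : Type*} [NormedAddCommGroup X] [NormedSpace ℝ X] [FiniteDimensional ℝ X]
    (e : V ≃L[ℝ] X)
    (S : Set (V →L[ℝ] V)ˣ) (hinv : ∀ s ∈ S, s⁻¹ ∈ S)
    (hS : ∀ s ∈ S, (∀ v, ‖e ((s : V →L[ℝ] V) v - v)‖ ≤ 1 / 16 * ‖e v‖) ∨
      (∀ v, ‖e (((s⁻¹ : (V →L[ℝ] V)ˣ) : V →L[ℝ] V) v - v)‖ ≤ 1 / 16 * ‖e v‖))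
    (δ : ℝ) (hδ : 0 < δ) :
    ∃ m, ∀ x ∈ iterComm S m, near δ x := by
  let Φ : (V →L[ℝ] V) ≃A[ℝ] (X →L[ℝ] X) := e.conjContinuousAlgEquiv
  have hΦ : ∀ a v, Φ a (e v) = e (a v) := fun a v => by simp [Φ]
  let Ψ : (V →L[ℝ] V)ˣ →* (X →L[ℝ] X)ˣ := Units.map (Φ : (V →L[ℝ] V) →* (X →L[ℝ] X))
  have hΨ : ∀ u : (V →L[ℝ] V)ˣ, ((Ψ u : (X →L[ℝ] X)ˣ) : X →L[ℝ] X) = Φ (u : V →L[ℝ] V) := fun u => rfl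
  have hsmall : ∀ u : (V →L[ℝ] V)ˣ, (∀ v, ‖e ((u : V →L[ℝ] V) v - v)‖ ≤ 1 / 16 * ‖e v‖) →
      ‖((Ψ u : (X →L[ℝ] X)ˣ) : X →L[ℝ] X) - 1‖ ≤ 1 / 16 := by
    intro u hu
    refine ContinuousLinearMap.opNorm_le_bound _ (by norm_num) fun x => ?_
    obtain ⟨v, rfl⟩ := e.surjective x
    rw [sub_apply, hΨ, hΦ, one_apply_eq_self, ← map_sub]
    exact hu v
  have hbase : ∀ s ∈ S, ‖((Ψ s : (X →L[ℝ] X)ˣ) : X →L[ℝ] X) - 1‖ ≤ 1 / 8 ∧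
      ‖(((Ψ s)⁻¹ : (X →L[ℝ] X)ˣ) : X →L[ℝ] X) - 1‖ ≤ 1 / 8 := by
    intro s hs
    rcases hS s hs with h | h
    · have := hsmall s h
      exact ⟨this.trans (by norm_num), inv_small _ this⟩
    · have h1 := hsmall _ h
      have h2 := inv_small _ h1
      rw [← map_inv, inv_inv] at h2
      rw [map_inv] at h1
      exact ⟨h2, h1.trans (by norm_num)⟩
  have hind : ∀ j, ∀ x ∈ iterComm S j,
      ‖((Ψ x : (X →L[ℝ] X)ˣ) : X →L[ℝ] X) - 1‖ ≤ 1 / 8 * (1 / 2) ^ j ∧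
      ‖(((Ψ x)⁻¹ : (X →L[ℝ] X)ˣ) : X →L[ℝ] X) - 1‖ ≤ 1 / 8 * (1 / 2) ^ j := by
    intro j
    induction j with
    | zero => intro x hx; simpa using hbase x hx
    | succ j ih =>
      rintro z ⟨s, hs, x, hx, rfl⟩
      have hle : (1 / 2 : ℝ) ^ j ≤ 1 := pow_le_one₀ (by norm_num) (by norm_num)
      have := comm_small_aux (Ψ s) (Ψ x) (1 / 8 * (1 / 2) ^ j) (by linarith)
        (hbase s hs).1 (hbase s hs).2 (ih x hx).1 (ih x hx).2
      rw [← map_inv, ← map_inv, ← map_mul, ← map_mul, ← map_mul] at this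
      rw [pow_succ, ← mul_assoc]
      exact this
  have hcont : Continuous Φ.symm := Φ.symm.continuous
  obtain ⟨δ', hδ', hcl⟩ := Metric.continuous_iff.1 hcont 1 δ hδ
  obtain ⟨m, hm⟩ := exists_pow_lt_of_lt_one hδ' (show (1 / 2 : ℝ) < 1 by norm_num)
  have hp : (0 : ℝ) < (1 / 2) ^ m := by positivity
  have hback : ∀ u : (V →L[ℝ] V)ˣ, ‖((Ψ u : (X →L[ℝ] X)ˣ) : X →L[ℝ] X) - 1‖ ≤ 1 / 8 * (1 / 2) ^ m →
      ‖(u : V →L[ℝ] V) - 1‖ < δ := by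
    intro u hu
    have := hcl _ (show dist ((Ψ u : (X →L[ℝ] X)ˣ) : X →L[ℝ] X) 1 < δ' by
      rw [dist_eq_norm]; linarith)
    rw [hΨ, map_one, dist_eq_norm] at this
    simpa using this
  refine ⟨m, fun x hx => ⟨hback x (hind m x hx).1, hback x⁻¹ ?_⟩⟩
  rw [map_inv]
  exact (hind m x hx).2

lemma bdd_add_one (Γ : Subgroup (V →L[ℝ] V)ˣ) (S : Set (V →L[ℝ] V)ˣ) (hinv : ∀ s ∈ S, s⁻¹ ∈ S)
    (hb : ∃ C : ℝ, ∀ g ∈ Γ, ‖(g : V →L[ℝ] V)‖ ≤ C)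
    (hn : ∀ s ∈ S, ∀ m ∈ Γ, s * m * s⁻¹ ∈ Γ) (x : (V →L[ℝ] V)ˣ) (hx : x ∈ Subgroup.closure S)
    (hxb : ∃ C : ℝ, ∀ n : ℤ, ‖((x ^ n : (V →L[ℝ] V)ˣ) : V →L[ℝ] V)‖ ≤ C)
    (hxc : ∀ s ∈ S, s * x * s⁻¹ * x⁻¹ ∈ Γ) :
    ∃ Γ' : Subgroup (V →L[ℝ] V)ˣ, Γ ≤ Γ' ∧ x ∈ Γ' ∧ (∃ C : ℝ, ∀ g ∈ Γ', ‖(g : V →L[ℝ] V)‖ ≤ C) ∧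
      (∀ s ∈ S, ∀ m ∈ Γ', s * m * s⁻¹ ∈ Γ') := by
  have hnorm : Subgroup.closure S ≤ Subgroup.normalizer (Γ : Set (V →L[ℝ] V)ˣ) := by
    rw [Subgroup.closure_le]
    intro s hs
    rw [SetLike.mem_coe, Subgroup.mem_normalizer_iff]
    intro h
    refine ⟨hn s hs h, fun hh => ?_⟩
    have := hn _ (hinv s hs) _ hh
    convert this using 1; group
  have hz : Subgroup.zpowers x ≤ Subgroup.normalizer (Γ : Set (V →L[ℝ] V)ˣ) := by
    rw [Subgroup.zpowers_le]; exact hnorm hx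
  have hmem : ∀ g ∈ Γ ⊔ Subgroup.zpowers x, ∃ a ∈ Γ, ∃ k : ℤ, g = a * x ^ k := by
    intro g hg
    have h1 : (g : (V →L[ℝ] V)ˣ) ∈ ((Γ ⊔ Subgroup.zpowers x : Subgroup (V →L[ℝ] V)ˣ) : Set _) := hg
    rw [Subgroup.coe_mul_of_right_le_normalizer_left _ _ hz] at h1
    obtain ⟨a, ha, b, ⟨k, rfl⟩, rfl⟩ := h1
    exact ⟨a, ha, k, rfl⟩
  have hxm : x ∈ Γ ⊔ Subgroup.zpowers x := Subgroup.mem_sup_right (Subgroup.mem_zpowers x)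
  refine ⟨Γ ⊔ Subgroup.zpowers x, le_sup_left, hxm, ?_, ?_⟩
  · obtain ⟨C, hC⟩ := hb
    obtain ⟨D, hD⟩ := hxb
    refine ⟨C * D, fun g hg => ?_⟩
    obtain ⟨a, ha, k, rfl⟩ := hmem g hg
    rw [Units.val_mul]
    exact (norm_mul_le _ _).trans (mul_le_mul (hC a ha) (hD k) (norm_nonneg _)
      ((norm_nonneg _).trans (hC a ha)))
  · intro s hs m hm
    obtain ⟨a, ha, k, rfl⟩ := hmem m hm
    have h1 : s * x * s⁻¹ ∈ Γ ⊔ Subgroup.zpowers x := by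
      have := mul_mem (Subgroup.mem_sup_left (T := Subgroup.zpowers x) (hxc s hs)) hxm
      simpa using this
    have h2 : s * (a * x ^ k) * s⁻¹ = (s * a * s⁻¹) * (s * x * s⁻¹) ^ k := by
      rw [conj_zpow]; group
    rw [h2]
    exact mul_mem (Subgroup.mem_sup_left (hn s hs a ha)) (zpow_mem h1 k)

lemma bdd_add_finite (S : Set (V →L[ℝ] V)ˣ) (hinv : ∀ s ∈ S, s⁻¹ ∈ S)
    (hxb : ∀ x ∈ Subgroup.closure S,
      ∃ C : ℝ, ∀ n : ℤ, ‖((x ^ n : (V →L[ℝ] V)ˣ) : V →L[ℝ] V)‖ ≤ C)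
    (Γ : Subgroup (V →L[ℝ] V)ˣ)
    (hb : ∃ C : ℝ, ∀ g ∈ Γ, ‖(g : V →L[ℝ] V)‖ ≤ C)
    (hn : ∀ s ∈ S, ∀ m ∈ Γ, s * m * s⁻¹ ∈ Γ) (T : Set (V →L[ℝ] V)ˣ) (hT : T.Finite) :
    T ⊆ Subgroup.closure S → (∀ x ∈ T, ∀ s ∈ S, s * x * s⁻¹ * x⁻¹ ∈ Γ) →
    ∃ Γ' : Subgroup (V →L[ℝ] V)ˣ, Γ ≤ Γ' ∧ T ⊆ Γ' ∧ (∃ C : ℝ, ∀ g ∈ Γ', ‖(g : V →L[ℝ] V)‖ ≤ C) ∧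
      (∀ s ∈ S, ∀ m ∈ Γ', s * m * s⁻¹ ∈ Γ') := by
  induction T, hT using Set.Finite.induction_on with
  | empty => exact fun _ _ => ⟨Γ, le_rfl, Set.empty_subset _, hb, hn⟩
  | @insert x T _ _ ih =>
    intro h1 h2
    obtain ⟨Γ1, l1, t1, b1, n1⟩ := ih (fun y hy => h1 (Set.mem_insert_of_mem _ hy))
      (fun y hy => h2 y (Set.mem_insert_of_mem _ hy))
    have hx := h1 (Set.mem_insert _ _)
    obtain ⟨Γ2, l2, t2, b2, n2⟩ := bdd_add_one Γ1 S hinv b1 n1 x hx (hxb x hx)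
      (fun s hs => l1 (h2 x (Set.mem_insert _ _) s hs))
    exact ⟨Γ2, l1.trans l2, Set.insert_subset t2 (t1.trans l2), b2, n2⟩

lemma bdd_closure_finite (H : Subgroup (V →L[ℝ] V)ˣ) (hH : IsClosed (H : Set (V →L[ℝ] V)ˣ))
    (hz : ∀ x ∈ H, ∃ C : ℝ, ∀ n : ℤ, ‖((x ^ n : (V →L[ℝ] V)ˣ) : V →L[ℝ] V)‖ ≤ C)
    {X : Type*} [NormedAddCommGroup X] [NormedSpace ℝ X] [FiniteDimensional ℝ X] (e : V ≃L[ℝ] X)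
    (S : Set (V →L[ℝ] V)ˣ) (hSH : S ⊆ H) (hSf : S.Finite) (hinv : ∀ s ∈ S, s⁻¹ ∈ S)
    (hS : ∀ s ∈ S, (∀ v, ‖e ((s : V →L[ℝ] V) v - v)‖ ≤ 1 / 16 * ‖e v‖) ∨
      (∀ v, ‖e (((s⁻¹ : (V →L[ℝ] V)ˣ) : V →L[ℝ] V) v - v)‖ ≤ 1 / 16 * ‖e v‖)) :
    ∃ C : ℝ, ∀ g ∈ Subgroup.closure S, ‖(g : V →L[ℝ] V)‖ ≤ C := by
  have hcl : Subgroup.closure S ≤ H := (Subgroup.closure_le _).2 hSH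
  obtain ⟨M, -, hMb, hMn, δ, hδ, hMδ⟩ := small_subgroup H hH (fun g hg => by
    obtain ⟨C, hC⟩ := hz g hg
    exact ⟨C, fun n => by simpa using hC n⟩) S hSf hSH
  obtain ⟨m, hm⟩ := iterComm_near e S hinv hS δ hδ
  have hdown : ∀ i ≤ m, ∃ Γ : Subgroup (V →L[ℝ] V)ˣ, iterComm S (m - i) ⊆ Γ ∧
      (∃ C : ℝ, ∀ g ∈ Γ, ‖(g : V →L[ℝ] V)‖ ≤ C) ∧ (∀ s ∈ S, ∀ m ∈ Γ, s * m * s⁻¹ ∈ Γ) := by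
    intro i
    induction i with
    | zero => exact fun _ => ⟨M, fun x hx => hMδ x (hcl (iterComm_sub S _ hx)) (hm x hx), hMb, hMn⟩
    | succ i ih =>
      intro hi
      obtain ⟨Γ, h1, h2, h3⟩ := ih (by omega)
      obtain ⟨Γ', -, k1, k2, k3⟩ := bdd_add_finite S hinv (fun x hx => hz x (hcl hx)) Γ h2 h3
        (iterComm S (m - (i + 1))) (iterComm_finite S hSf _) (iterComm_sub S _) (by
          intro x hx s hs
          have : m - i = (m - (i + 1)) + 1 := by omega
          rw [this] at h1
          exact h1 ⟨s, hs, x, hx, rfl⟩)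
      exact ⟨Γ', k1, k2, k3⟩
  obtain ⟨Γ, h1, ⟨C, hC⟩, -⟩ := hdown m le_rfl
  rw [Nat.sub_self] at h1
  exact ⟨C, fun g hg => hC g ((Subgroup.closure_le _).2 h1 hg)⟩

end

open Module MeasureTheory
set_option linter.unusedSectionVars false

lemma exists_finite_closure {G : Type*} [Group G] (U : Set G) (g : G)
    (hg : g ∈ Subgroup.closure U) : ∃ S ⊆ U, S.Finite ∧ g ∈ Subgroup.closure S := by
  induction hg using Subgroup.closure_induction with
  | mem x hx => exact ⟨{x}, by simpa using hx, Set.finite_singleton x,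
      Subgroup.subset_closure rfl⟩
  | one => exact ⟨∅, Set.empty_subset _, Set.finite_empty, one_mem _⟩
  | mul x y _ _ hx hy =>
    obtain ⟨S, h1, h2, h3⟩ := hx
    obtain ⟨T, k1, k2, k3⟩ := hy
    exact ⟨S ∪ T, Set.union_subset h1 k1, h2.union k2,
      mul_mem (Subgroup.closure_mono Set.subset_union_left h3)
        (Subgroup.closure_mono Set.subset_union_right k3)⟩
  | inv x _ hx =>
    obtain ⟨S, h1, h2, h3⟩ := hx
    exact ⟨S, h1, h2, inv_mem h3⟩

lemma exists_finite_closure_set {G : Type*} [Group G] (U : Set G) (F : Set G) (hF : F.Finite)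
    (hFU : F ⊆ Subgroup.closure U) : ∃ S ⊆ U, S.Finite ∧ F ⊆ Subgroup.closure S := by
  choose! f h1 h2 h3 using exists_finite_closure U
  refine ⟨⋃ x ∈ F, f x, Set.iUnion₂_subset fun x hx => h1 x (hFU hx),
    hF.biUnion fun x hx => h2 x (hFU hx), fun x hx => ?_⟩
  exact Subgroup.closure_mono (Set.subset_biUnion_of_mem (u := f) hx) (h3 x (hFU hx))

section
variable {V : Type*} [NormedAddCommGroup V] [NormedSpace ℝ V] [FiniteDimensional ℝ V]

lemma cr_of_bdd (Γ0 H : Subgroup (V →L[ℝ] V)ˣ) (hH : IsClosed (H : Set (V →L[ℝ] V)ˣ))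
    (hpb : ∀ g ∈ H, ∃ C : ℝ, ∀ n : ℕ, ‖(g : V →L[ℝ] V) ^ n‖ ≤ C) (hΓ : Γ0 ≤ H)
    (hb : ∃ C : ℝ, ∀ g ∈ Γ0, ‖(g : V →L[ℝ] V)‖ ≤ C)
    (W : Submodule ℝ V) (hW : ∀ g ∈ Γ0, ∀ w ∈ W, (g : V →L[ℝ] V) w ∈ W) :
    ∃ W' : Submodule ℝ V, (∀ g ∈ Γ0, ∀ w ∈ W', (g : V →L[ℝ] V) w ∈ W') ∧ IsCompl W W' := by
  obtain ⟨C, hC⟩ := hb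
  set Γ := Γ0.topologicalClosure with hΓd
  have hcl : IsClosed (Γ : Set (V →L[ℝ] V)ˣ) := Γ0.isClosed_topologicalClosure
  have hΓH : Γ ≤ H := Γ0.topologicalClosure_minimal hΓ hH
  have hbd : ∀ g ∈ Γ, ‖(g : V →L[ℝ] V)‖ ≤ C := by
    intro g hg
    exact closure_minimal (t := {g : (V →L[ℝ] V)ˣ | ‖(g : V →L[ℝ] V)‖ ≤ C}) hC
      (isClosed_le Units.continuous_val.norm continuous_const) hg
  have hWΓ : ∀ g ∈ Γ, ∀ w ∈ W, (g : V →L[ℝ] V) w ∈ W := by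
    intro g hg w hw
    refine closure_minimal (t := {g : (V →L[ℝ] V)ˣ | (g : V →L[ℝ] V) w ∈ W})
      (fun g hg => hW g hg w hw) ?_ hg
    have h1 : IsClosed (W : Set V) := W.closed_of_finiteDimensional
    exact h1.preimage ((ContinuousLinearMap.apply ℝ V w).continuous.comp Units.continuous_val)
  have hΓc : Subgroup.closure (Γ : Set (V →L[ℝ] V)ˣ) = Γ := Subgroup.closure_eq Γ
  obtain ⟨W', h1, h2⟩ := cr_closure Set.univ (Γ : Set (V →L[ℝ] V)ˣ) isOpen_univ
    (by rw [hΓc]; exact hcl) (by rw [hΓc, Set.univ_inter]) ⟨1, Γ.one_mem⟩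
    (by rw [hΓc]; exact fun g hg => hpb g (hΓH hg)) C
    (fun g hg => ⟨hbd g hg, hbd _ (Γ.inv_mem hg)⟩)
    (by rw [hΓc]; exact fun g hg h hh => mul_mem (mul_mem hg hh) (inv_mem hg)) W
    (by rw [hΓc]; exact hWΓ)
  rw [hΓc] at h1
  exact ⟨W', fun g hg => h1 g (Γ0.le_topologicalClosure hg), h2⟩

lemma bdd_of_ell (H : Subgroup (V →L[ℝ] V)ˣ) (hH : IsClosed (H : Set (V →L[ℝ] V)ˣ))
    (hz : ∀ x ∈ H, ∃ C : ℝ, ∀ n : ℤ, ‖((x ^ n : (V →L[ℝ] V)ˣ) : V →L[ℝ] V)‖ ≤ C) :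
    ∃ C : ℝ, ∀ g ∈ H, ‖(g : V →L[ℝ] V)‖ ≤ C := by
  have hpb : ∀ g ∈ H, ∃ C : ℝ, ∀ n : ℕ, ‖(g : V →L[ℝ] V) ^ n‖ ≤ C := by
    intro g hg
    obtain ⟨C, hC⟩ := hz g hg
    exact ⟨C, fun n => by simpa using hC n⟩
  let σ : H →* (V →ₗ[ℝ] V) :=
    (ContinuousLinearMap.toLinearMapRingHom : (V →L[ℝ] V) →+* (V →ₗ[ℝ] V)).toMonoidHom.comp
      ((Units.coeHom (V →L[ℝ] V)).comp H.subtype)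
  obtain ⟨U, ⟨ι, _, c, hc⟩, hU⟩ := exists_big (finrank ℝ V) V le_rfl σ
    (fun g => pb_of_norm _ (hpb g g.2)) (1 / 16) (by norm_num)
  set U' : Set (V →L[ℝ] V)ˣ := Subtype.val '' U with hU'
  have hU'H : U' ⊆ H := by rintro _ ⟨x, -, rfl⟩; exact x.2
  set N := Subgroup.closure U' with hN
  have hNH : N ≤ H := (Subgroup.closure_le _).2 hU'H
  -- finite subsets of `U` generate bounded subgroups
  have hfin : ∀ S ⊆ U', S.Finite → ∃ C : ℝ, ∀ g ∈ Subgroup.closure S, ‖(g : V →L[ℝ] V)‖ ≤ C := by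
    intro S hSU hSf
    obtain ⟨X, _, _, e, he⟩ := hU (Subtype.val ⁻¹' S)
      (hSf.preimage Subtype.val_injective.injOn) (by
        intro x hx
        obtain ⟨y, hy, hxy⟩ := hSU hx
        rwa [← Subtype.ext hxy])
    have : FiniteDimensional ℝ X := LinearEquiv.finiteDimensional e
    have he' : ∀ s ∈ S, ∀ v, ‖e.toContinuousLinearEquiv ((s : V →L[ℝ] V) v - v)‖ ≤
        1 / 16 * ‖e.toContinuousLinearEquiv v‖ :=
      fun s hs v => he ⟨s, hU'H (hSU hs)⟩ hs v
    obtain ⟨C, hC⟩ := bdd_closure_finite H hH hz e.toContinuousLinearEquiv (S ∪ S⁻¹)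
      (Set.union_subset (hSU.trans hU'H) (fun s hs => by
        have := H.inv_mem (hU'H (hSU hs))
        rwa [inv_inv] at this))
      (hSf.union hSf.inv)
      (by
        rintro s (hs | hs)
        · exact Or.inr (by simpa using hs)
        · exact Or.inl hs)
      (by
        rintro s (hs | hs)
        · exact Or.inl (he' s hs)
        · exact Or.inr (he' _ hs))
    exact ⟨C, fun g hg => hC g (Subgroup.closure_mono Set.subset_union_left hg)⟩
  -- `N` is bounded
  have hNb : ∃ C : ℝ, ∀ g ∈ N, ‖(g : V →L[ℝ] V)‖ ≤ C := by
    refine bdd_of_cr_subgroup N (fun g hg => hpb g (hNH hg)) ?_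
    set Z : Set (V →L[ℝ] V) := Units.val '' (N : Set (V →L[ℝ] V)ˣ) with hZ
    obtain ⟨F, hFZ, hFs⟩ := Submodule.fg_span_iff_fg_span_finset_subset Z |>.1
      (IsNoetherian.noetherian (Submodule.span ℝ Z))
    obtain ⟨S, hSU, hSf, hFS⟩ := exists_finite_closure_set U' (Units.val ⁻¹' (F : Set (V →L[ℝ] V)))
      (F.finite_toSet.preimage Units.val_injective.injOn) (by
        intro x hx
        obtain ⟨y, hy, hxy⟩ := hFZ hx
        rwa [← Units.ext hxy])
    intro W hW
    have hSN : Subgroup.closure S ≤ N := Subgroup.closure_mono hSU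
    obtain ⟨W', h1, h2⟩ := cr_of_bdd (Subgroup.closure S) H hH hpb (hSN.trans hNH)
      (hfin S hSU hSf) W (fun g hg => hW g (hSN hg))
    refine ⟨W', ?_, h2⟩
    intro g hg w hw
    have hgs : (g : V →L[ℝ] V) ∈ Submodule.span ℝ (F : Set (V →L[ℝ] V)) := by
      rw [← hFs]; exact Submodule.subset_span ⟨g, hg, rfl⟩
    generalize (g : V →L[ℝ] V) = a at hgs
    induction hgs using Submodule.span_induction with
    | mem x hx =>
      obtain ⟨y, hy, rfl⟩ := hFZ hx
      exact h1 y (hFS hx) w hw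
    | zero => simp
    | add x y _ _ hx hy => exact W'.add_mem hx hy
    | smul a x _ hx => exact W'.smul_mem a hx
  -- finitely many cosets
  obtain ⟨C, hC⟩ := hNb
  have hp : ∀ i : ι, ∃ p : H, (∃ h, c h = i) → c p = i := by
    intro i
    by_cases hi : ∃ h, c h = i
    · obtain ⟨h, hh⟩ := hi
      exact ⟨h, fun _ => hh⟩
    · exact ⟨1, fun h => absurd h hi⟩
  choose p hp using hp
  obtain ⟨D, hD⟩ := (Set.finite_range fun i => ‖((p i : (V →L[ℝ] V)ˣ) : V →L[ℝ] V)‖).bddAbove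
  refine ⟨D * C, fun g hg => ?_⟩
  set i := c ⟨g, hg⟩ with hi
  have h1 := hc (p i) ⟨g, hg⟩ (hp i ⟨_, hi.symm⟩)
  have h2 : (p i : (V →L[ℝ] V)ˣ)⁻¹ * g ∈ N := Subgroup.subset_closure ⟨_, h1, rfl⟩
  have h3 : g = (p i : (V →L[ℝ] V)ˣ) * ((p i : (V →L[ℝ] V)ˣ)⁻¹ * g) := by group
  have h4 : ‖((p i : (V →L[ℝ] V)ˣ) : V →L[ℝ] V)‖ ≤ D := hD ⟨i, rfl⟩
  rw [h3, Units.val_mul]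
  exact (norm_mul_le _ _).trans (mul_le_mul h4 (hC _ h2) (norm_nonneg _) ((norm_nonneg _).trans h4))

end

theorem closed_subgroup_of_elliptic_elements_compact {V : Type*}
    [NormedAddCommGroup V] [NormedSpace ℝ V] [FiniteDimensional ℝ V]
    (H : Subgroup (V →L[ℝ] V)ˣ)
    (hclosed : IsClosed (H : Set (V →L[ℝ] V)ˣ))
    (hell : ∀ g ∈ H, IsCompact (closure (Set.range fun n : ℤ => g ^ n))) :
    IsCompact (H : Set (V →L[ℝ] V)ˣ) := by
  obtain ⟨C, hC⟩ := bdd_of_ell H hclosed (fun g hg => zpow_bdd_of_ell g (hell g hg))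
  exact (units_compact (V := V) C).of_isClosed_subset hclosed
    (fun g hg => ⟨hC g hg, hC _ (H.inv_mem hg)⟩)
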